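/- arXiv:math/0508289 — 2 statements merged into one kernel-verified Lean document; each statement's English description precedes it below -/
import Mathlib

section
/- Let n = 2 and p(u) = −u³ + A_0 u² + A_1 u + A_2 with A_0, A_1, A_2 ∈ 𝔷, so that K³ = A_0 K² + A_1 K + A_2 in 𝒦_p. Then for any pair ξ, ζ ∈ 𝔷 such that ζξ = A_2, the element K(x) := K² + (ξx − A_0)K + (ζ − x⁻¹(x²ξ² − A_0 ξ x − A_1))/(x − x⁻¹) of 𝒦_p(x) is a solution of the reflection equation with spectral parameter. Moreover, if 𝔷 is a field, then every non-trivial solution K(x) ∈ 𝒦_p(x) is of this form up to a factor from 𝔷(x). -/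
noncomputable section
namespace Baxterization
open scoped TensorProduct

/-! ## The affine Hecke algebra of rank one -/

variable (k : Type) [Field k]
variable (z : Type) [CommRing z] [Algebra k z]

/-- the two generators R and K -/
inductive G : Type | R | K

/-- The defining relations of the affine Hecke algebra of rank one:
the Hecke condition `R² = ωR + 1` and the reflection equation `RKRK = KRKR`. -/
inductive HRel (ω : z) : FreeAlgebra z G → FreeAlgebra z G → Prop
  | hecke : HRel ω (FreeAlgebra.ι z G.R * FreeAlgebra.ι z G.R)
      (ω • FreeAlgebra.ι z G.R + 1)
  | re : HRel ω (FreeAlgebra.ι z G.R * FreeAlgebra.ι z G.K * FreeAlgebra.ι z G.R *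
        FreeAlgebra.ι z G.K)
      (FreeAlgebra.ι z G.K * FreeAlgebra.ι z G.R * FreeAlgebra.ι z G.K * FreeAlgebra.ι z G.R)

/-- The affine Hecke algebra of rank one over 𝔷, with parameter ω: the quotient of the
free algebra 𝔷⟨R,K⟩ by the ideal of relations `R² = ωR + 1` and `RKRK = KRKR`. -/
def H (ω : z) : Type := RingQuot (HRel z ω)

variable (ω : z)

instance : Ring (H z ω) := inferInstanceAs (Ring (RingQuot (HRel z ω)))
instance : Algebra z (H z ω) := inferInstanceAs (Algebra z (RingQuot (HRel z ω)))
instance : Algebra k (H z ω) := inferInstanceAs (Algebra k (RingQuot (HRel z ω)))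
instance : IsScalarTower k z (H z ω) :=
  inferInstanceAs (IsScalarTower k z (RingQuot (HRel z ω)))

/-- the generator R of the affine Hecke algebra -/
def Rg : H z ω := RingQuot.mkAlgHom z (HRel z ω) (FreeAlgebra.ι z G.R)
/-- the generator K of the affine Hecke algebra -/
def Kg : H z ω := RingQuot.mkAlgHom z (HRel z ω) (FreeAlgebra.ι z G.K)
/-- Y = RKR -/
def Yg : H z ω := Rg z ω * Kg z ω * Rg z ω

/-- the elements e_{i;j} = KⁱRKʲ - KʲRKⁱ of the affine Hecke algebra -/
def eH (i j : ℕ) : H z ω :=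
  Kg z ω ^ i * Rg z ω * Kg z ω ^ j - Kg z ω ^ j * Rg z ω * Kg z ω ^ i

/-! ## The cyclotomic Hecke algebra -/

/-- the element p(K) of H, where p(u) = -u^(n+1) + A₀ uⁿ + A₁ u^(n-1) + ⋯ + Aₙ -/
def pKelt (n : ℕ) (A : ℕ → z) : H z ω :=
  - (Kg z ω) ^ (n + 1) + ∑ i ∈ Finset.range (n + 1), A i • (Kg z ω) ^ (n - i)

/-- relation generating the two-sided ideal (p(K)) of H -/
inductive CRel (n : ℕ) (A : ℕ → z) : H z ω → H z ω → Prop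
  | mk : CRel n A (pKelt z ω n A) 0

/-- The cyclotomic Hecke algebra H_p: the quotient of the affine Hecke algebra H by the
two-sided ideal generated by p(K), where p(u) = -u^(n+1) + A₀ uⁿ + ⋯ + Aₙ. -/
def Hp (n : ℕ) (A : ℕ → z) : Type := RingQuot (CRel z ω n A)

instance (n : ℕ) (A : ℕ → z) : Ring (Hp z ω n A) :=
  inferInstanceAs (Ring (RingQuot (CRel z ω n A)))
instance (n : ℕ) (A : ℕ → z) : Algebra z (Hp z ω n A) :=
  inferInstanceAs (Algebra z (RingQuot (CRel z ω n A)))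
instance (n : ℕ) (A : ℕ → z) : Algebra k (Hp z ω n A) :=
  inferInstanceAs (Algebra k (RingQuot (CRel z ω n A)))
instance (n : ℕ) (A : ℕ → z) : IsScalarTower k z (Hp z ω n A) :=
  inferInstanceAs (IsScalarTower k z (RingQuot (CRel z ω n A)))

/-- the image of R in the cyclotomic Hecke algebra -/
def Rp (n : ℕ) (A : ℕ → z) : Hp z ω n A :=
  RingQuot.mkAlgHom z (CRel z ω n A) (Rg z ω)
/-- the image of K in the cyclotomic Hecke algebra -/
def Kp (n : ℕ) (A : ℕ → z) : Hp z ω n A :=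
  RingQuot.mkAlgHom z (CRel z ω n A) (Kg z ω)
/-- Y = RKR in the cyclotomic Hecke algebra -/
def Yp (n : ℕ) (A : ℕ → z) : Hp z ω n A := Rp z ω n A * Kp z ω n A * Rp z ω n A

/-- the elements e_{i;j} = KⁱRKʲ - KʲRKⁱ of the cyclotomic Hecke algebra -/
def eHp (n : ℕ) (A : ℕ → z) (i j : ℕ) : Hp z ω n A :=
  Kp z ω n A ^ i * Rp z ω n A * Kp z ω n A ^ j -
    Kp z ω n A ^ j * Rp z ω n A * Kp z ω n A ^ i

/-- the element K̃ = Kⁿ - A₀K^(n-1) - ⋯ - A_(n-1) of the cyclotomic Hecke algebra -/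
def Ktil (n : ℕ) (A : ℕ → z) : Hp z ω n A :=
  Kp z ω n A ^ n - ∑ i ∈ Finset.range n, A i • Kp z ω n A ^ (n - 1 - i)

/-! ## Rational functions in one and two variables, and the spectral reflection equation -/

/-- polynomials in two variables x, y over the base field -/
abbrev P2 := MvPolynomial (Fin 2) k
/-- the field k(x,y) of rational functions in the two variables x, y -/
abbrev F2 := FractionRing (P2 k)

/-- auxiliary: the embedding k[X] → k(x,y), X ↦ i-th variable -/
def embP (i : Fin 2) : Polynomial k →ₐ[k] F2 k :=
  (IsScalarTower.toAlgHom k (P2 k) (F2 k)).comp (Polynomial.aeval (MvPolynomial.X i))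

lemma embP_injective (i : Fin 2) : Function.Injective (embP k i) := by
  have h : ((MvPolynomial.aeval (R := k) (fun j => if j = i then Polynomial.X else 0)).comp
      (Polynomial.aeval (R := k) (MvPolynomial.X i : P2 k))) = AlgHom.id k (Polynomial k) := by
    apply Polynomial.algHom_ext; simp
  have hinj : Function.Injective (Polynomial.aeval (R := k) (MvPolynomial.X i : P2 k)) := by
    intro a b hab
    have h2 := congrArg (MvPolynomial.aeval (R := k)
      (fun j : Fin 2 => if j = i then (Polynomial.X : Polynomial k) else 0)) hab
    have ha := congrFun (congrArg (fun (f : Polynomial k →ₐ[k] Polynomial k) =>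
      (f : Polynomial k → Polynomial k)) h) a
    have hb := congrFun (congrArg (fun (f : Polynomial k →ₐ[k] Polynomial k) =>
      (f : Polynomial k → Polynomial k)) h) b
    simp only [AlgHom.coe_comp, Function.comp_apply, AlgHom.coe_id, id_eq] at ha hb
    rw [← ha, ← hb]; exact h2
  exact (IsFractionRing.injective (P2 k) (F2 k)).comp hinj

/-- the embedding k(x) → k(x,y) sending the variable to the i-th of the two variables -/
def emb (i : Fin 2) : RatFunc k →ₐ[k] F2 k :=
  RatFunc.liftAlgHom (embP k i)
    (nonZeroDivisors_le_comap_nonZeroDivisors_of_injective _ (embP_injective k i))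

/-- the first spectral variable x, as an element of k(x,y) -/
def xvar : F2 k := algebraMap (P2 k) (F2 k) (MvPolynomial.X 0)
/-- the second spectral variable y, as an element of k(x,y) -/
def yvar : F2 k := algebraMap (P2 k) (F2 k) (MvPolynomial.X 1)

variable {B : Type} [Ring B] [Algebra k B]

/-- substitution of the spectral variable x by the i-th of the two variables x, y:
the map B(x) → B(x,y) induced by `emb i`. -/
def iota (i : Fin 2) : RatFunc k ⊗[k] B →ₐ[k] F2 k ⊗[k] B :=
  Algebra.TensorProduct.map (emb k i) (AlgHom.id k B)

/-- the baxterized R-matrix `R(t) = R - t⁻¹ R⁻¹` (note `R⁻¹ = R - ω` by the Hecke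
condition), as an element of B(x,y). -/
def RxElt (ωk : k) (Relt : B) (t : F2 k) : F2 k ⊗[k] B :=
  (1 : F2 k) ⊗ₜ[k] Relt - t⁻¹ • ((1 : F2 k) ⊗ₜ[k] (Relt - algebraMap k B ωk))

/-- `c`, viewed as an element `K(x)` of `B(x)`, satisfies the reflection equation with
spectral parameter:  `R(x/y) K(x) R(xy) K(y) = K(y) R(xy) K(x) R(x/y)` in B(x,y). -/
def IsSol (ωk : k) (Relt : B) (c : RatFunc k ⊗[k] B) : Prop :=
  RxElt k ωk Relt (xvar k / yvar k) * iota k 0 c * RxElt k ωk Relt (xvar k * yvar k) *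
      iota k 1 c =
    iota k 1 c * RxElt k ωk Relt (xvar k * yvar k) * iota k 0 c *
      RxElt k ωk Relt (xvar k / yvar k)

variable [Algebra z B]

/-- `c` lies in `𝔷(x)·1`, i.e. `c` is a scalar element of `B(x)`
(an element with trivial B-component). -/
def IsScalarElt (c : RatFunc k ⊗[k] B) : Prop :=
  c ∈ Submodule.span (RatFunc k)
    (Set.range fun a : z => (1 : RatFunc k) ⊗ₜ[k] (algebraMap z B a))

/-- the functions φ_i(ξ,x) (φ₀ = 1, φ_{i+1} = φ_i·ξx - A_i),
viewed as (central, scalar) elements of B(x). -/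
def phiT (ξ : z) (A : ℕ → z) : ℕ → RatFunc k ⊗[k] B
  | 0 => 1
  | (i + 1) => phiT ξ A i * ((RatFunc.X : RatFunc k) ⊗ₜ[k] algebraMap z B ξ)
      - (1 : RatFunc k) ⊗ₜ[k] (algebraMap z B (A i))

/-- the principal baxterized element
`K_p(ξ,ζ,x) = ∑_{i=0}^{n-1} φ_i(ξ,x) K^{n-i} + (ζ - x⁻¹ φ_n(ξ,x))/(x - x⁻¹)`,
as an element of 𝒦_p(x) ⊆ H_p(x). -/
def KxMain (n : ℕ) (A : ℕ → z) (ξ ζ : z) : RatFunc k ⊗[k] Hp z ω n A :=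
  (∑ i ∈ Finset.range n,
      phiT k z (B := Hp z ω n A) ξ A i * ((1 : RatFunc k) ⊗ₜ[k] (Kp z ω n A) ^ (n - i))) +
    ((RatFunc.X - RatFunc.X⁻¹)⁻¹ : RatFunc k) •
      ((1 : RatFunc k) ⊗ₜ[k] algebraMap z (Hp z ω n A) ζ -
        (RatFunc.X⁻¹ : RatFunc k) • phiT k z (B := Hp z ω n A) ξ A n)

/-- the scalar function ψ(ξ,ζ,x) = (-ξⁿx^{n+1} + ∑_{i=0}^{n-1} A_i ξ^{n-1-i} x^{n-i} + ζ)/(x-x⁻¹),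
viewed as a (scalar) element of H_p(x). -/
def psiT (n : ℕ) (A : ℕ → z) (ξ ζ : z) : RatFunc k ⊗[k] Hp z ω n A :=
  ((RatFunc.X - RatFunc.X⁻¹)⁻¹ : RatFunc k) •
    (((∑ i ∈ Finset.range n,
        (RatFunc.X ^ (n - i) : RatFunc k) ⊗ₜ[k]
          algebraMap z (Hp z ω n A) (A i * ξ ^ (n - 1 - i))) +
      (1 : RatFunc k) ⊗ₜ[k] algebraMap z (Hp z ω n A) ζ) -
      ((RatFunc.X ^ (n + 1) : RatFunc k) ⊗ₜ[k] algebraMap z (Hp z ω n A) (ξ ^ n)))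

/-- An element of 𝒦_p(x) is a *principal* solution if n = 1, or if n > 1 and the
coefficient of K^(n-1) in its expansion over the basis {1, K, …, K^(n-1), K̃} of 𝒦_p,
where K̃ = Kⁿ - A₀K^(n-1) - ⋯ - A_(n-1), is non-zero. -/
def IsPrincipal (n : ℕ) (A : ℕ → z) (c : RatFunc k ⊗[k] Hp z ω n A) : Prop :=
  n = 1 ∨ (1 < n ∧ ∃ f : ℕ → RatFunc k ⊗[k] Hp z ω n A,
    (∀ i, IsScalarElt k z (B := Hp z ω n A) (f i)) ∧
    c = (∑ i ∈ Finset.range n, f i * ((1 : RatFunc k) ⊗ₜ[k] (Kp z ω n A) ^ i)) +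
        f n * ((1 : RatFunc k) ⊗ₜ[k] Ktil z ω n A) ∧
    f (n - 1) ≠ 0)

/-! ## Commutative auxiliaries: the polynomial p, the functions φ and the coefficients A⁽ᵐ⁾ -/

/-- the polynomial p(u) = -u^(n+1) + A₀ uⁿ + ⋯ + Aₙ -/
def pPoly (n : ℕ) (A : ℕ → z) : Polynomial z :=
  - Polynomial.X ^ (n + 1) +
    ∑ i ∈ Finset.range (n + 1), Polynomial.C (A i) * Polynomial.X ^ (n - i)

/-- the polynomials φ_i(ξ,x) ∈ 𝔷[x]: φ₀ = 1, φ_{i+1} = φ_i·ξx - A_i -/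
def phiP (A : ℕ → z) (ξ : z) : ℕ → Polynomial z
  | 0 => 1
  | (i + 1) => phiP A ξ i * (Polynomial.C ξ * Polynomial.X) - Polynomial.C (A i)

/-- the monic polynomial u^(n+1) - A₀uⁿ - ⋯ - Aₙ (i.e. -p(u)) -/
def qPoly (n : ℕ) (A : ℕ → z) : Polynomial z :=
  Polynomial.X ^ (n + 1) -
    ∑ i ∈ Finset.range (n + 1), Polynomial.C (A i) * Polynomial.X ^ (n - i)

/-- the coefficients A⁽ᵐ⁾_i ∈ 𝔷 defined by uᵐ ≡ ∑_{i=0}^n A⁽ᵐ⁾_i u^{n-i}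
modulo the monic polynomial u^(n+1) - A₀uⁿ - ⋯ - Aₙ -/
def Am (n : ℕ) (A : ℕ → z) (m i : ℕ) : z :=
  ((Polynomial.X : Polynomial z) ^ m %ₘ qPoly z n A).coeff (n - i)

/-- polynomials in two variables over 𝔷 -/
abbrev ZP2 := MvPolynomial (Fin 2) z

/-- the embedding 𝔷[u] → 𝔷[x,y] sending u to the i-th variable -/
def evP (i : Fin 2) : Polynomial z →ₐ[z] ZP2 z := Polynomial.aeval (MvPolynomial.X i)

/-- The subalgebra 𝒦_p(x) of H_p(x): rational functions of x with values in the
subalgebra 𝒦_p ⊆ H_p generated by K (over 𝔷). -/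
def KpX (n : ℕ) (A : ℕ → z) : Subalgebra (RatFunc k) (RatFunc k ⊗[k] Hp z ω n A) :=
  Algebra.adjoin (RatFunc k)
    ({(1 : RatFunc k) ⊗ₜ[k] Kp z ω n A} ∪
      Set.range (fun a : z => (1 : RatFunc k) ⊗ₜ[k] algebraMap z (Hp z ω n A) a))


/-- the baxterized element K(x) = K² + (ξx − A₀)K + (ζ − x⁻¹(x²ξ² − A₀ξx − A₁))/(x − x⁻¹)
for the cubic case -/
def Kcub (A : ℕ → z) (xi zeta : z) : RatFunc k ⊗[k] Hp z ω 2 A :=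
  (1 : RatFunc k) ⊗ₜ[k] Kp z ω 2 A ^ 2 +
    ((RatFunc.X : RatFunc k) ⊗ₜ[k] algebraMap z (Hp z ω 2 A) xi -
        (1 : RatFunc k) ⊗ₜ[k] algebraMap z (Hp z ω 2 A) (A 0)) *
      ((1 : RatFunc k) ⊗ₜ[k] Kp z ω 2 A) +
    ((RatFunc.X - RatFunc.X⁻¹)⁻¹ : RatFunc k) •
      ((1 : RatFunc k) ⊗ₜ[k] algebraMap z (Hp z ω 2 A) zeta -
        (RatFunc.X⁻¹ : RatFunc k) •
          (((RatFunc.X ^ 2 : RatFunc k) ⊗ₜ[k] algebraMap z (Hp z ω 2 A) (xi ^ 2) -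
              (RatFunc.X : RatFunc k) ⊗ₜ[k] algebraMap z (Hp z ω 2 A) (A 0 * xi)) -
            (1 : RatFunc k) ⊗ₜ[k] algebraMap z (Hp z ω 2 A) (A 1)))

section ReflectionDefect

variable {S E : Type} [CommRing S] [Ring E] [Algebra S E] {R K : E} {w : S}

lemma reflection_comm_sq_left (hR : R * R = w • R + 1) (hRK : R * K * R * K = K * R * K * R) :
    R * K ^ 2 * R * K - K * (R * K ^ 2 * R) = -(w • (K * R * K ^ 2 - K ^ 2 * R * K)) := by
  have hinv : (R - w • 1) * R = 1 := by rw [sub_mul, hR]; simp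
  have hinv' : R * (R - w • 1) = 1 := by rw [mul_sub, hR]; simp
  have e1 : R * K ^ 2 * R = R * K * R * R * K * R - w • (R * K * R * K * R) := by
    calc R * K ^ 2 * R = R * K * (R * (R - w • 1)) * K * R := by
          rw [hinv']; simp only [pow_two, mul_one, mul_assoc]
      _ = _ := by
          simp only [mul_sub, sub_mul, mul_smul_comm, smul_mul_assoc, mul_one, mul_assoc]
  have hY : R * K * R * R * K * R * K = K * (R * K * R * R * K * R) := by
    calc R * K * R * R * K * R * K = R * K * R * (R * K * R * K) := by simp only [mul_assoc]
      _ = R * K * R * (K * R * K * R) := by rw [hRK]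
      _ = R * K * R * K * (R * K * R) := by simp only [mul_assoc]
      _ = _ := by rw [hRK]; simp only [mul_assoc]
  have h1 : R * K * R * K * R * K = w • (K * (R * K * R * K)) + K * R * K ^ 2 := by
    calc R * K * R * K * R * K = K * R * K * (R * R) * K := by rw [hRK]; simp only [mul_assoc]
      _ = _ := by
        rw [hR]
        simp only [mul_add, add_mul, mul_smul_comm, smul_mul_assoc, mul_one, pow_two, mul_assoc]
  have h2 : K * (R * K * R * K * R) = w • (K * (R * K * R * K)) + K ^ 2 * R * K := by
    calc K * (R * K * R * K * R) = K * K * R * K * (R * R) := by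
          rw [hRK]; simp only [mul_assoc]
      _ = w • (K * (K * R * K * R)) + K ^ 2 * R * K := by
        rw [hR]
        simp only [mul_add, mul_smul_comm, mul_one, pow_two, mul_assoc]
      _ = _ := by rw [← hRK]
  rw [e1, sub_mul, mul_sub, hY, smul_mul_assoc, mul_smul_comm, h1, h2]
  module

lemma reflection_comm_sq_right (hRK : R * K * R * K = K * R * K * R) :
    R * K * R * K ^ 2 = K ^ 2 * (R * K * R) := by
  calc R * K * R * K ^ 2 = R * K * R * K * K := by simp only [pow_two, mul_assoc]
    _ = K * R * K * R * K := by rw [hRK]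
    _ = K * (R * K * R * K) := by simp only [mul_assoc]
    _ = _ := by rw [hRK]; simp only [pow_two, mul_assoc]

lemma reflection_comm_sq_sq (hR : R * R = w • R + 1) (hRK : R * K * R * K = K * R * K * R)
    {A₀ A₁ A₂ : S} (hK : K ^ 3 = A₀ • K ^ 2 + A₁ • K + A₂ • 1) :
    R * K ^ 2 * R * K ^ 2 - K ^ 2 * (R * K ^ 2 * R) =
      -((w * A₀) • (K * R * K ^ 2 - K ^ 2 * R * K)) + (w * A₂) • (R * K - K * R) := by
  have h := reflection_comm_sq_left hR hRK
  have hK' : K * K ^ 2 = A₀ • K ^ 2 + A₁ • K + A₂ • 1 := by rw [← hK, pow_succ' K 2]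
  have hK'' : K ^ 2 * K = A₀ • K ^ 2 + A₁ • K + A₂ • 1 := by rw [← hK, pow_succ K 2]
  have h3 : R * K ^ 2 * R * K ^ 2 - K ^ 2 * (R * K ^ 2 * R) =
      (R * K ^ 2 * R * K - K * (R * K ^ 2 * R)) * K +
        K * (R * K ^ 2 * R * K - K * (R * K ^ 2 * R)) := by
    simp only [pow_two]; noncomm_ring
  have h4 : K * R * K ^ 2 * K = A₀ • (K * R * K ^ 2) + A₁ • (K * R * K) + A₂ • (K * R) := by
    rw [mul_assoc, hK'']
    simp only [mul_add, mul_smul_comm, mul_one]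
  have h5 : K * (K ^ 2 * R * K) = A₀ • (K ^ 2 * R * K) + A₁ • (K * R * K) + A₂ • (R * K) := by
    rw [← mul_assoc, ← mul_assoc, hK']
    simp only [add_mul, smul_mul_assoc, one_mul]
  have h6 : K ^ 2 * R * K * K = K * (K * R * K ^ 2) := by
    simp only [pow_two, mul_assoc]
  rw [h3, h, neg_mul, mul_neg, smul_mul_assoc, mul_smul_comm, sub_mul, mul_sub, h4, h5, h6]
  module

/-- The defect of the spectral reflection equation for quadratic polynomials in `K`, expanded in
terms of the three antisymmetric elements `RK - KR`, `RK² - K²R` and `KRK² - K²RK`. -/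
lemma reflection_defect (hR : R * R = w • R + 1) (hRK : R * K * R * K = K * R * K * R)
    {A₀ A₁ A₂ : S} (hK : K ^ 3 = A₀ • K ^ 2 + A₁ • K + A₂ • 1)
    (α β γ δ a b d a' b' d' : S) :
    (α • R + β • 1) * (a • K ^ 2 + b • K + d • 1) * (γ • R + δ • 1) *
        (a' • K ^ 2 + b' • K + d' • 1) -
      (a' • K ^ 2 + b' • K + d' • 1) * (γ • R + δ • 1) * (a • K ^ 2 + b • K + d • 1) *
        (α • R + β • 1) =
    (w * α * γ * (a * a' * A₂ + d * b') +
        α * δ * (a * a' * (A₀ * A₁ + A₂) + (a * b' + b * a') * A₁ + b * d' + d * b') +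
        β * γ * (d * b' - b * d')) • (R * K - K * R) +
      (w * α * γ * (d * a') +
        α * δ * (a * a' * (A₀ ^ 2 + A₁) + (a * b' + b * a') * A₀ + a * d' + b * b' + d * a') +
        β * γ * (d * a' - a * d')) • (R * K ^ 2 - K ^ 2 * R) +
      (-(w * α * γ * a * (A₀ * a' + b')) + β * γ * (b * a' - a * b')) •
        (K * R * K ^ 2 - K ^ 2 * R * K) := by
  have hK' : K * K ^ 2 = A₀ • K ^ 2 + A₁ • K + A₂ • 1 := by rw [← hK, pow_succ' K 2]
  have hK'' : K ^ 2 * K = A₀ • K ^ 2 + A₁ • K + A₂ • 1 := by rw [← hK, pow_succ K 2]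
  have hK4 : K ^ 2 * K ^ 2 = (A₀ ^ 2 + A₁) • K ^ 2 + (A₀ * A₁ + A₂) • K + (A₀ * A₂) • 1 := by
    have : K ^ 2 * K ^ 2 = K * K ^ 2 * K := by simp only [pow_two, mul_assoc]
    rw [this, hK', add_mul, add_mul, smul_mul_assoc, smul_mul_assoc, smul_mul_assoc, hK'',
      ← pow_two, one_mul]
    module
  have key : ∀ u v : E, u * v = v * u →
      (α • R + β • 1) * u * (γ • R + δ • 1) * v - v * (γ • R + δ • 1) * u * (α • R + β • 1) =
      (α * γ) • (R * u * R * v - v * (R * u * R)) + (α * δ) • (R * (u * v) - u * v * R) +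
        (β * γ) • (u * R * v - v * R * u) := by
    intro u v huv
    simp only [add_mul, mul_add, smul_mul_assoc, mul_smul_comm, one_mul, mul_one, smul_add,
      smul_sub, smul_smul, mul_assoc, huv]
    module
  have huv : (a • K ^ 2 + b • K + d • 1) * (a' • K ^ 2 + b' • K + d' • 1) =
      (a * a' * (A₀ ^ 2 + A₁) + (a * b' + b * a') * A₀ + a * d' + b * b' + d * a') • K ^ 2 +
      (a * a' * (A₀ * A₁ + A₂) + (a * b' + b * a') * A₁ + b * d' + d * b') • K +
      (a * a' * (A₀ * A₂) + (a * b' + b * a') * A₂ + d * d') • 1 := by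
    simp only [add_mul, mul_add, smul_mul_assoc, mul_smul_comm, one_mul, mul_one, hK', hK'', hK4,
      ← pow_two K]
    module
  have hvu : (a • K ^ 2 + b • K + d • 1) * (a' • K ^ 2 + b' • K + d' • 1) =
      (a' • K ^ 2 + b' • K + d' • 1) * (a • K ^ 2 + b • K + d • 1) := by
    simp only [add_mul, mul_add, smul_mul_assoc, mul_smul_comm, one_mul, mul_one, hK', hK'']
    module
  have hc : R * (a • K ^ 2 + b • K + d • 1) * R * (a' • K ^ 2 + b' • K + d' • 1) -
      (a' • K ^ 2 + b' • K + d' • 1) * (R * (a • K ^ 2 + b • K + d • 1) * R) =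
      (a * a') • (R * K ^ 2 * R * K ^ 2 - K ^ 2 * (R * K ^ 2 * R)) +
      (a * b') • (R * K ^ 2 * R * K - K * (R * K ^ 2 * R)) +
      (b * a') • (R * K * R * K ^ 2 - K ^ 2 * (R * K * R)) +
      (b * b') • (R * K * R * K - K * R * K * R) +
      (d * a') • (R * R * K ^ 2 - K ^ 2 * (R * R)) + (d * b') • (R * R * K - K * (R * R)) := by
    simp only [add_mul, mul_add, smul_mul_assoc, mul_smul_comm, one_mul, mul_one, smul_add,
      smul_sub, smul_smul, mul_assoc]
    module
  rw [key _ _ hvu, huv, hc, reflection_comm_sq_sq hR hRK hK, reflection_comm_sq_left hR hRK,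
    reflection_comm_sq_right hRK, hRK, hR]
  simp only [add_mul, mul_add, smul_mul_assoc, mul_smul_comm, one_mul, mul_one, smul_add,
    smul_sub, smul_smul, mul_assoc]
  module

end ReflectionDefect

section InducedModule

variable {L : Type} [CommRing L]

/-- The action of `K` on the left module induced from the character `R ↦ q`, in coordinates with
respect to the basis `KᵃYᵇ` (ordered as `a + 3b`), where `Y = RKR`. -/
def indK (A₀ A₁ A₂ : L) : Module.End L (Fin 9 → L) where
  toFun f := ![A₂ * f 2, f 0 + A₁ * f 2, f 1 + A₀ * f 2,
    A₂ * f 5, f 3 + A₁ * f 5, f 4 + A₀ * f 5,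
    A₂ * f 8, f 6 + A₁ * f 8, f 7 + A₀ * f 8]
  map_add' f g := by ext i; fin_cases i <;> simp <;> ring
  map_smul' c f := by ext i; fin_cases i <;> simp <;> ring

/-- The action of `R` on the left module induced from the character `R ↦ q`, in coordinates with
respect to the basis `KᵃYᵇ` (ordered as `a + 3b`); the argument `p` stands for `q⁻¹`. -/
def indR (q p : L) : Module.End L (Fin 9 → L) where
  toFun f := ![q * f 0, q * f 3, q * f 6,
    p * f 1 + (q - p) * f 3, (q - p) * (f 6 - f 2) + q * f 4, q * f 7,
    p * f 2 + (q - p) * f 6, p * f 5 + (q - p) * f 7, q * f 8]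
  map_add' f g := by ext i; fin_cases i <;> simp <;> ring
  map_smul' c f := by ext i; fin_cases i <;> simp <;> ring

lemma indR_sq {q p : L} (h : q * p = 1) : indR q p * indR q p = (q - p) • indR q p + 1 := by
  apply LinearMap.ext
  intro f
  ext i
  fin_cases i <;> simp [indR] <;> grind

lemma indR_indK (q p : L) (A₀ A₁ A₂ : L) :
    indR q p * indK A₀ A₁ A₂ * indR q p * indK A₀ A₁ A₂ =
      indK A₀ A₁ A₂ * indR q p * indK A₀ A₁ A₂ * indR q p := by
  apply LinearMap.ext
  intro f
  ext i
  fin_cases i <;> simp [indR, indK] <;> grind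

lemma indK_cube (A₀ A₁ A₂ : L) :
    indK A₀ A₁ A₂ ^ 3 = A₀ • indK A₀ A₁ A₂ ^ 2 + A₁ • indK A₀ A₁ A₂ + A₂ • 1 := by
  apply LinearMap.ext
  intro f
  ext i
  fin_cases i <;> simp [indK, pow_succ] <;> ring

lemma ind_antisymm_independent {q p : L} (h : q * p = 1) (A₀ A₁ A₂ : L) {c₁ c₂ c₃ : L}
    (hc : c₁ • (indR q p * indK A₀ A₁ A₂ - indK A₀ A₁ A₂ * indR q p) +
      c₂ • (indR q p * indK A₀ A₁ A₂ ^ 2 - indK A₀ A₁ A₂ ^ 2 * indR q p) +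
      c₃ • (indK A₀ A₁ A₂ * indR q p * indK A₀ A₁ A₂ ^ 2 -
        indK A₀ A₁ A₂ ^ 2 * indR q p * indK A₀ A₁ A₂) = 0) :
    c₁ = 0 ∧ c₂ = 0 ∧ c₃ = 0 := by
  have hv := fun i => congrFun (LinearMap.congr_fun hc (Pi.single 0 1)) i
  have h3 := hv 3
  have h6 := hv 6
  have h7 := hv 7
  simp [indR, indK, pow_succ] at h3 h6 h7
  have hp : ∀ c : L, c * p = 0 → c = 0 := fun c hcp => by
    linear_combination q * hcp - c * h
  exact ⟨hp _ h3, hp _ h6, hp _ h7⟩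

end InducedModule

section CyclotomicRelations

lemma Rp_mul_self (n : ℕ) (A : ℕ → z) :
    Rp z ω n A * Rp z ω n A = ω • Rp z ω n A + 1 := by
  have h : Rg z ω * Rg z ω = ω • Rg z ω + 1 := by
    have := RingQuot.mkAlgHom_rel z (HRel.hecke (z := z) (ω := ω))
    rw [map_mul, map_add, map_smul, map_one] at this
    exact this
  have := congrArg (RingQuot.mkAlgHom z (CRel z ω n A)) h
  rw [map_mul, map_add, map_smul, map_one] at this
  exact this

lemma Rp_Kp_comm (n : ℕ) (A : ℕ → z) :
    Rp z ω n A * Kp z ω n A * Rp z ω n A * Kp z ω n A =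
      Kp z ω n A * Rp z ω n A * Kp z ω n A * Rp z ω n A := by
  have h : Rg z ω * Kg z ω * Rg z ω * Kg z ω = Kg z ω * Rg z ω * Kg z ω * Rg z ω := by
    have := RingQuot.mkAlgHom_rel z (HRel.re (z := z) (ω := ω))
    simp only [map_mul] at this
    exact this
  have := congrArg (RingQuot.mkAlgHom z (CRel z ω n A)) h
  simp only [map_mul] at this
  exact this

lemma Kp_cube (A : ℕ → z) :
    Kp z ω 2 A ^ 3 = A 0 • Kp z ω 2 A ^ 2 + A 1 • Kp z ω 2 A + A 2 • 1 := by
  have h := RingQuot.mkAlgHom_rel z (CRel.mk (z := z) (ω := ω) (n := 2) (A := A))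
  rw [map_zero] at h
  simp only [pKelt, Finset.sum_range_succ, Finset.sum_range_zero, map_add, map_neg, map_pow,
    map_smul, map_one, pow_zero, pow_one, Nat.sub_zero, Nat.reduceAdd, Nat.reduceSub,
    zero_add] at h
  exact (neg_add_eq_zero.mp h)

/-- The homomorphism out of the affine Hecke algebra determined by images of `R` and `K` satisfying
the defining relations. -/
def HLift {E : Type} [Ring E] [Algebra z E] (R K : E) (hR : R * R = ω • R + 1)
    (hRK : R * K * R * K = K * R * K * R) : H z ω →ₐ[z] E :=
  RingQuot.liftAlgHom z ⟨FreeAlgebra.lift z (fun g => G.casesOn g R K), by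
    rintro _ _ (_ | _)
    · simpa using hR
    · simpa using hRK⟩

lemma HLift_Rg {E : Type} [Ring E] [Algebra z E] (R K : E) (hR : R * R = ω • R + 1)
    (hRK : R * K * R * K = K * R * K * R) : HLift z ω R K hR hRK (Rg z ω) = R := by
  refine (RingQuot.liftAlgHom_mkAlgHom_apply z _ _ _).trans ?_
  simp

lemma HLift_Kg {E : Type} [Ring E] [Algebra z E] (R K : E) (hR : R * R = ω • R + 1)
    (hRK : R * K * R * K = K * R * K * R) : HLift z ω R K hR hRK (Kg z ω) = K := by
  refine (RingQuot.liftAlgHom_mkAlgHom_apply z _ _ _).trans ?_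
  simp

/-- The homomorphism out of the cubic cyclotomic Hecke algebra determined by images of `R` and `K`
satisfying the defining relations. -/
def HpLift {E : Type} [Ring E] [Algebra z E] (A : ℕ → z) (R K : E) (hR : R * R = ω • R + 1)
    (hRK : R * K * R * K = K * R * K * R) (hK : K ^ 3 = A 0 • K ^ 2 + A 1 • K + A 2 • 1) :
    Hp z ω 2 A →ₐ[z] E :=
  RingQuot.liftAlgHom z ⟨HLift z ω R K hR hRK, by
    rintro _ _ ⟨⟩
    simp only [pKelt, Finset.sum_range_succ, Finset.sum_range_zero, map_add, map_neg, map_pow,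
      map_smul, pow_zero, pow_one, Nat.sub_zero, Nat.reduceAdd, Nat.reduceSub,
      zero_add, map_zero, map_one, HLift_Kg, hK, neg_add_cancel]⟩

lemma HpLift_Rp {E : Type} [Ring E] [Algebra z E] (A : ℕ → z) (R K : E) (hR : R * R = ω • R + 1)
    (hRK : R * K * R * K = K * R * K * R) (hK : K ^ 3 = A 0 • K ^ 2 + A 1 • K + A 2 • 1) :
    HpLift z ω A R K hR hRK hK (Rp z ω 2 A) = R :=
  (RingQuot.liftAlgHom_mkAlgHom_apply z _ _ _).trans (HLift_Rg z ω R K hR hRK)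

lemma HpLift_Kp {E : Type} [Ring E] [Algebra z E] (A : ℕ → z) (R K : E) (hR : R * R = ω • R + 1)
    (hRK : R * K * R * K = K * R * K * R) (hK : K ^ 3 = A 0 • K ^ 2 + A 1 • K + A 2 • 1) :
    HpLift z ω A R K hR hRK hK (Kp z ω 2 A) = K :=
  (RingQuot.liftAlgHom_mkAlgHom_apply z _ _ _).trans (HLift_Kg z ω R K hR hRK)

end CyclotomicRelations

section ScalarExtension

variable (F : Type) [Field F] [Algebra k F]
variable (B' : Type) [Ring B'] [Algebra k B'] [Algebra z B'] [IsScalarTower k z B']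

/-- The inclusion of scalars `F ⊗ 𝔷 → F ⊗ B`. -/
def scalT : F ⊗[k] z →ₐ[F] F ⊗[k] B' :=
  Algebra.TensorProduct.map (AlgHom.id F F) (IsScalarTower.toAlgHom k z B')

lemma scalT_tmul (r : F) (a : z) :
    scalT k z F B' (r ⊗ₜ[k] a) = r ⊗ₜ[k] algebraMap z B' a := by
  simp [scalT]

lemma scalT_commutes (a : F ⊗[k] z) (m : F ⊗[k] B') :
    scalT k z F B' a * m = m * scalT k z F B' a := by
  induction a with
  | zero => simp
  | add a b ha hb => rw [map_add, add_mul, mul_add, ha, hb]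
  | tmul r a =>
    induction m with
    | zero => simp
    | add m m' hm hm' => rw [add_mul, mul_add, hm, hm']
    | tmul s b =>
      rw [scalT_tmul, Algebra.TensorProduct.tmul_mul_tmul, Algebra.TensorProduct.tmul_mul_tmul,
        mul_comm, Algebra.commutes]

/-- `F ⊗ B` as an algebra over `F ⊗ 𝔷`. -/
abbrev scalAlgebra : Algebra (F ⊗[k] z) (F ⊗[k] B') :=
  (scalT k z F B').toRingHom.toAlgebra' (scalT_commutes k z F B')

lemma isScalarElt_scalT (a : RatFunc k ⊗[k] z) :
    IsScalarElt k z (scalT k z (RatFunc k) B' a) := by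
  induction a with
  | zero => rw [map_zero]; exact Submodule.zero_mem _
  | add a b ha hb => rw [map_add]; exact Submodule.add_mem _ ha hb
  | tmul r a =>
    rw [scalT_tmul]
    have h : r ⊗ₜ[k] algebraMap z B' a = r • ((1 : RatFunc k) ⊗ₜ[k] algebraMap z B' a) := by
      rw [TensorProduct.smul_tmul', smul_eq_mul, mul_one]
    rw [h]
    exact Submodule.smul_mem _ _ (Submodule.subset_span ⟨a, rfl⟩)

lemma iota_tmul (i : Fin 2) (r : RatFunc k) (b : B') :
    iota k i (r ⊗ₜ[k] b) = emb k i r ⊗ₜ[k] b := by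
  simp [iota]

lemma iota_scalT (i : Fin 2) (a : RatFunc k ⊗[k] z) :
    iota k i (scalT k z (RatFunc k) B' a) = scalT k z (F2 k) B' (iota k i a) := by
  induction a with
  | zero => simp
  | add a b ha hb => simp only [map_add, ha, hb]
  | tmul r a => simp only [scalT_tmul, iota_tmul]

lemma RxElt_eq (ωk : k) (R : B') (t : F2 k) :
    RxElt k ωk R t = scalT k z (F2 k) B' ((1 - t⁻¹) ⊗ₜ[k] 1) * ((1 : F2 k) ⊗ₜ[k] R) +
      scalT k z (F2 k) B' (t⁻¹ ⊗ₜ[k] algebraMap k z ωk) := by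
  rw [RxElt, scalT_tmul, scalT_tmul, map_one, Algebra.TensorProduct.tmul_mul_tmul, one_mul,
    mul_one, ← IsScalarTower.algebraMap_apply, TensorProduct.tmul_sub, smul_sub,
    TensorProduct.smul_tmul', TensorProduct.smul_tmul', smul_eq_mul, mul_one,
    TensorProduct.sub_tmul]
  abel

end ScalarExtension

section Quadratic

variable (F : Type) [Field F] [Algebra k F]

/-- The element `a K² + b K + d` of `F ⊗ H_p`, for scalars `a b d`. -/
def quadT (A : ℕ → z) (a b d : F ⊗[k] z) : F ⊗[k] Hp z ω 2 A :=
  scalT k z F (Hp z ω 2 A) a * ((1 : F) ⊗ₜ[k] Kp z ω 2 A) ^ 2 +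
    scalT k z F (Hp z ω 2 A) b * ((1 : F) ⊗ₜ[k] Kp z ω 2 A) + scalT k z F (Hp z ω 2 A) d

lemma iota_quadT (i : Fin 2) (A : ℕ → z) (a b d : RatFunc k ⊗[k] z) :
    iota k i (quadT k z ω (RatFunc k) A a b d) =
      quadT k z ω (F2 k) A (iota k i a) (iota k i b) (iota k i d) := by
  have h : iota k i ((1 : RatFunc k) ⊗ₜ[k] Kp z ω 2 A) = (1 : F2 k) ⊗ₜ[k] Kp z ω 2 A := by
    rw [iota_tmul, map_one]
  rw [quadT, quadT, map_add, map_add, map_mul, map_mul, map_pow, iota_scalT, iota_scalT,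
    iota_scalT, h]

/-- The constant coefficient of the cubic baxterized element. -/
def cubConst (A : ℕ → z) (xi zeta : z) : RatFunc k ⊗[k] z :=
  ((RatFunc.X - RatFunc.X⁻¹)⁻¹ : RatFunc k) •
    ((1 : RatFunc k) ⊗ₜ[k] zeta -
      (RatFunc.X⁻¹ : RatFunc k) •
        (((RatFunc.X ^ 2 : RatFunc k) ⊗ₜ[k] (xi ^ 2) -
            (RatFunc.X : RatFunc k) ⊗ₜ[k] (A 0 * xi)) - (1 : RatFunc k) ⊗ₜ[k] (A 1)))

lemma Kcub_eq (A : ℕ → z) (xi zeta : z) :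
    Kcub k z ω A xi zeta = quadT k z ω (RatFunc k) A 1
      ((RatFunc.X : RatFunc k) ⊗ₜ[k] xi - (1 : RatFunc k) ⊗ₜ[k] A 0)
      (cubConst k z A xi zeta) := by
  simp only [Kcub, quadT, cubConst, map_one, map_sub, map_smul, scalT_tmul, one_mul]

lemma emb_X_zero : emb k 0 RatFunc.X = xvar k := by
  simp [emb, embP, xvar, ← RatFunc.algebraMap_X, RatFunc.liftAlgHom_apply]

lemma emb_X_one : emb k 1 RatFunc.X = yvar k := by
  simp [emb, embP, yvar, ← RatFunc.algebraMap_X, RatFunc.liftAlgHom_apply]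

end Quadratic

section Defect

variable {S E : Type} [CommRing S] [Ring E] [Algebra S E]

/-- The defect of the spectral reflection equation for `a K² + b K + d`, after applying a
homomorphism `Φ` which is compatible with a homomorphism `φ` of scalars. -/
lemma spectral_defect (ωk : k) (hω : ω = algebraMap k z ωk) (A : ℕ → z)
    (φ : F2 k ⊗[k] z →+* S) (Φ : F2 k ⊗[k] Hp z ω 2 A →+* E)
    (hΦ : ∀ s, Φ (scalT k z (F2 k) (Hp z ω 2 A) s) = algebraMap S E (φ s))
    {R K : E} (hR : Φ ((1 : F2 k) ⊗ₜ[k] Rp z ω 2 A) = R) (hK : Φ ((1 : F2 k) ⊗ₜ[k] Kp z ω 2 A) = K)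
    (s t : F2 k) (a b d a' b' d' : F2 k ⊗[k] z) {α β γ δ a₁ b₁ d₁ a₂ b₂ d₂ w A₀ A₁ A₂ : S}
    (hα : φ ((1 - s⁻¹) ⊗ₜ[k] 1) = α) (hβ : φ (s⁻¹ ⊗ₜ[k] ω) = β)
    (hγ : φ ((1 - t⁻¹) ⊗ₜ[k] 1) = γ) (hδ : φ (t⁻¹ ⊗ₜ[k] ω) = δ)
    (ha₁ : φ a = a₁) (hb₁ : φ b = b₁) (hd₁ : φ d = d₁)
    (ha₂ : φ a' = a₂) (hb₂ : φ b' = b₂) (hd₂ : φ d' = d₂)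
    (hw : φ ((1 : F2 k) ⊗ₜ[k] ω) = w) (hA₀ : φ ((1 : F2 k) ⊗ₜ[k] A 0) = A₀)
    (hA₁ : φ ((1 : F2 k) ⊗ₜ[k] A 1) = A₁) (hA₂ : φ ((1 : F2 k) ⊗ₜ[k] A 2) = A₂) :
    Φ (RxElt k ωk (Rp z ω 2 A) s * quadT k z ω (F2 k) A a b d * RxElt k ωk (Rp z ω 2 A) t *
        quadT k z ω (F2 k) A a' b' d' -
      quadT k z ω (F2 k) A a' b' d' * RxElt k ωk (Rp z ω 2 A) t * quadT k z ω (F2 k) A a b d *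
        RxElt k ωk (Rp z ω 2 A) s) =
    (w * α * γ * (a₁ * a₂ * A₂ + d₁ * b₂) +
        α * δ * (a₁ * a₂ * (A₀ * A₁ + A₂) + (a₁ * b₂ + b₁ * a₂) * A₁ + b₁ * d₂ + d₁ * b₂) +
        β * γ * (d₁ * b₂ - b₁ * d₂)) • (R * K - K * R) +
      (w * α * γ * (d₁ * a₂) +
        α * δ * (a₁ * a₂ * (A₀ ^ 2 + A₁) + (a₁ * b₂ + b₁ * a₂) * A₀ + a₁ * d₂ + b₁ * b₂ +
          d₁ * a₂) +
        β * γ * (d₁ * a₂ - a₁ * d₂)) • (R * K ^ 2 - K ^ 2 * R) +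
      (-(w * α * γ * a₁ * (A₀ * a₂ + b₂)) + β * γ * (b₁ * a₂ - a₁ * b₂)) •
        (K * R * K ^ 2 - K ^ 2 * R * K) := by
  have hs (c : z) (m : Hp z ω 2 A) : Φ ((1 : F2 k) ⊗ₜ[k] (c • m)) =
      φ ((1 : F2 k) ⊗ₜ[k] c) • Φ ((1 : F2 k) ⊗ₜ[k] m) := by
    rw [Algebra.smul_def, Algebra.smul_def, ← hΦ, ← map_mul, scalT_tmul,
      Algebra.TensorProduct.tmul_mul_tmul, one_mul]
  have h1 : Φ ((1 : F2 k) ⊗ₜ[k] (1 : Hp z ω 2 A)) = 1 := map_one Φ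
  have hRR : R * R = w • R + 1 := by
    have := congrArg (fun m => Φ ((1 : F2 k) ⊗ₜ[k] m)) (Rp_mul_self z ω 2 A)
    simp only [TensorProduct.tmul_add, map_add, hs, h1, hR, hw] at this
    rw [← this, ← hR, ← map_mul, Algebra.TensorProduct.tmul_mul_tmul, one_mul]
  have hRK : R * K * R * K = K * R * K * R := by
    simp only [← hR, ← hK, ← map_mul, Algebra.TensorProduct.tmul_mul_tmul, Rp_Kp_comm]
  have hK3 : K ^ 3 = A₀ • K ^ 2 + A₁ • K + A₂ • 1 := by
    have hpow (n : ℕ) : Φ ((1 : F2 k) ⊗ₜ[k] (Kp z ω 2 A ^ n)) = K ^ n := by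
      rw [← hK, ← map_pow, Algebra.TensorProduct.tmul_pow, one_pow]
    have := congrArg (fun m => Φ ((1 : F2 k) ⊗ₜ[k] m)) (Kp_cube z ω A)
    simpa only [TensorProduct.tmul_add, map_add, hs, h1, hK, hpow, hA₀, hA₁, hA₂] using this
  have hquad (a b d : F2 k ⊗[k] z) : Φ (quadT k z ω (F2 k) A a b d) =
      φ a • K ^ 2 + φ b • K + φ d • 1 := by
    rw [quadT, map_add, map_add, map_mul, map_mul, hΦ, hΦ, hΦ, map_pow, hK, Algebra.smul_def,
      Algebra.smul_def, Algebra.smul_def, mul_one]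
  have hRx (t : F2 k) : Φ (RxElt k ωk (Rp z ω 2 A) t) =
      φ ((1 - t⁻¹) ⊗ₜ[k] 1) • R + φ (t⁻¹ ⊗ₜ[k] ω) • 1 := by
    rw [RxElt_eq k z, map_add, map_mul, hΦ, hΦ, hR, ← hω, Algebra.smul_def,
      Algebra.smul_def, mul_one]
  simp only [map_sub, map_mul, hquad, hRx, hα, hβ, hγ, hδ, ha₁, hb₁, hd₁, ha₂, hb₂, hd₂]
  exact reflection_defect hRR hRK hK3 α β γ δ a₁ b₁ d₁ a₂ b₂ d₂

end Defect

section Existence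

lemma xvar_ne_zero : xvar k ≠ 0 := by
  simp [xvar]

lemma yvar_ne_zero : yvar k ≠ 0 := by
  simp [yvar]

lemma ratFunc_X_sub_inv_ne_zero : (RatFunc.X - RatFunc.X⁻¹ : RatFunc k) ≠ 0 := by
  intro h
  have h1 : (RatFunc.X : RatFunc k) * RatFunc.X = 1 := by
    nth_rewrite 2 [sub_eq_zero.mp h]
    exact mul_inv_cancel₀ RatFunc.X_ne_zero
  have h2 : (Polynomial.X : Polynomial k) * Polynomial.X = 1 := by
    apply RatFunc.algebraMap_injective k
    simpa [RatFunc.algebraMap_X] using h1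
  have h3 := congrArg (Polynomial.eval 0) h2
  simp at h3

lemma X_sub_inv_mul_cubConst (A : ℕ → z) (xi zeta : z) :
    ((RatFunc.X : RatFunc k) ⊗ₜ[k] 1 - (RatFunc.X⁻¹ : RatFunc k) ⊗ₜ[k] 1) *
        cubConst k z A xi zeta =
      (1 : RatFunc k) ⊗ₜ[k] zeta - ((RatFunc.X⁻¹ : RatFunc k) ⊗ₜ[k] 1) *
        (((RatFunc.X : RatFunc k) ⊗ₜ[k] 1) ^ 2 * ((1 : RatFunc k) ⊗ₜ[k] xi) ^ 2 -
          ((RatFunc.X : RatFunc k) ⊗ₜ[k] 1) *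
            (((1 : RatFunc k) ⊗ₜ[k] A 0) * ((1 : RatFunc k) ⊗ₜ[k] xi)) -
          (1 : RatFunc k) ⊗ₜ[k] A 1) := by
  have h (r : RatFunc k) (c : RatFunc k ⊗[k] z) : (r ⊗ₜ[k] (1 : z)) * c = r • c := by
    rw [Algebra.smul_def]; rfl
  rw [← TensorProduct.sub_tmul, h, cubConst, smul_inv_smul₀ (ratFunc_X_sub_inv_ne_zero k)]
  simp only [Algebra.TensorProduct.tmul_pow, Algebra.TensorProduct.tmul_mul_tmul, one_mul, mul_one,
    one_pow]
  rw [h]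

lemma cubic_defect_coeff {S : Type} [CommRing S] {x xi y yi d d' ξ ζ A₀ A₁ A₂ : S} (w : S)
    (hx : x * xi = 1) (hy : y * yi = 1)
    (hd : (x - xi) * d = ζ - xi * (x ^ 2 * ξ ^ 2 - x * (A₀ * ξ) - A₁))
    (hd' : (y - yi) * d' = ζ - yi * (y ^ 2 * ξ ^ 2 - y * (A₀ * ξ) - A₁)) (hA : ζ * ξ = A₂) :
    w * (1 - xi * y) * (1 - xi * yi) * (1 * 1 * A₂ + d * (y * ξ - A₀)) +
        (1 - xi * y) * (xi * yi * w) * (1 * 1 * (A₀ * A₁ + A₂) +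
          (1 * (y * ξ - A₀) + (x * ξ - A₀) * 1) * A₁ + (x * ξ - A₀) * d' + d * (y * ξ - A₀)) +
        xi * y * w * (1 - xi * yi) * (d * (y * ξ - A₀) - (x * ξ - A₀) * d') = 0 ∧
      w * (1 - xi * y) * (1 - xi * yi) * (d * 1) +
        (1 - xi * y) * (xi * yi * w) * (1 * 1 * (A₀ ^ 2 + A₁) +
          (1 * (y * ξ - A₀) + (x * ξ - A₀) * 1) * A₀ + 1 * d' +
            (x * ξ - A₀) * (y * ξ - A₀) + d * 1) +
        xi * y * w * (1 - xi * yi) * (d * 1 - 1 * d') = 0 ∧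
      -(w * (1 - xi * y) * (1 - xi * yi) * 1 * (A₀ * 1 + (y * ξ - A₀))) +
        xi * y * w * (1 - xi * yi) * ((x * ξ - A₀) * 1 - 1 * (y * ξ - A₀)) = 0 := by
  have h1 : (1 - xi * y) * (1 - xi * yi) * (A₂ + d * (y * ξ - A₀)) +
      (1 - xi * y) * (xi * yi) * ((A₀ * A₁ + A₂) + ((y * ξ - A₀) + (x * ξ - A₀)) * A₁ +
        (x * ξ - A₀) * d' + d * (y * ξ - A₀)) +
      xi * y * (1 - xi * yi) * (d * (y * ξ - A₀) - (x * ξ - A₀) * d') = 0 := by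
    grind
  have h2 : (1 - xi * y) * (1 - xi * yi) * d +
      (1 - xi * y) * (xi * yi) * (A₀ ^ 2 + A₁ + ((y * ξ - A₀) + (x * ξ - A₀)) * A₀ + d' +
        (x * ξ - A₀) * (y * ξ - A₀) + d) + xi * y * (1 - xi * yi) * (d - d') = 0 := by
    grind
  refine ⟨?_, ?_, ?_⟩
  · linear_combination w * h1
  · linear_combination w * h2
  · linear_combination w * ξ * y * (1 - xi * yi) * hx

theorem isSol_Kcub (ωk : k) (hω : ω = algebraMap k z ωk) (A : ℕ → z) (xi zeta : z)
    (hA : zeta * xi = A 2) : IsSol k ωk (Rp z ω 2 A) (Kcub k z ω A xi zeta) := by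
  have zero_comb {S E : Type} [CommRing S] [Ring E] [Algebra S E] (a b c : E) :
      (0 : S) • a + (0 : S) • b + (0 : S) • c = 0 := by simp
  let := scalAlgebra k z (F2 k) (Hp z ω 2 A)
  have hd (i : Fin 2) := congrArg (iota k i) (X_sub_inv_mul_cubConst k z A xi zeta)
  simp only [map_mul, map_sub, map_pow, iota_tmul, map_one, map_inv₀] at hd
  have hx := hd 0
  have hy := hd 1
  rw [emb_X_zero] at hx
  rw [emb_X_one] at hy
  have hxx : (xvar k ⊗ₜ[k] 1 : F2 k ⊗[k] z) * ((xvar k)⁻¹ ⊗ₜ[k] 1) = 1 := by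
    rw [Algebra.TensorProduct.tmul_mul_tmul, mul_inv_cancel₀ (xvar_ne_zero k), one_mul]; rfl
  have hyy : (yvar k ⊗ₜ[k] 1 : F2 k ⊗[k] z) * ((yvar k)⁻¹ ⊗ₜ[k] 1) = 1 := by
    rw [Algebra.TensorProduct.tmul_mul_tmul, mul_inv_cancel₀ (yvar_ne_zero k), one_mul]; rfl
  have hA' : ((1 : F2 k) ⊗ₜ[k] zeta) * ((1 : F2 k) ⊗ₜ[k] xi) = (1 : F2 k) ⊗ₜ[k] A 2 := by
    rw [Algebra.TensorProduct.tmul_mul_tmul, hA, one_mul]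
  have hs : (xvar k / yvar k)⁻¹ = (xvar k)⁻¹ * yvar k := by
    rw [inv_div, div_eq_mul_inv, mul_comm]
  obtain ⟨h₁, h₂, h₃⟩ := cubic_defect_coeff ((1 : F2 k) ⊗ₜ[k] ω) hxx hyy hx hy hA'
  rw [IsSol, Kcub_eq, iota_quadT, iota_quadT, ← sub_eq_zero]
  refine (spectral_defect k z ω (S := F2 k ⊗[k] z) (E := F2 k ⊗[k] Hp z ω 2 A)
    ωk hω A (RingHom.id _) (RingHom.id _) (fun _ => rfl) rfl rfl
    (xvar k / yvar k) (xvar k * yvar k) _ _ _ _ _ _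
    (α := 1 - ((xvar k)⁻¹ ⊗ₜ[k] 1) * (yvar k ⊗ₜ[k] 1))
    (β := ((xvar k)⁻¹ ⊗ₜ[k] 1) * (yvar k ⊗ₜ[k] 1) * ((1 : F2 k) ⊗ₜ[k] ω))
    (γ := 1 - ((xvar k)⁻¹ ⊗ₜ[k] 1) * ((yvar k)⁻¹ ⊗ₜ[k] 1))
    (δ := ((xvar k)⁻¹ ⊗ₜ[k] 1) * ((yvar k)⁻¹ ⊗ₜ[k] 1) * ((1 : F2 k) ⊗ₜ[k] ω))
    (a₁ := 1) (b₁ := (xvar k ⊗ₜ[k] 1) * ((1 : F2 k) ⊗ₜ[k] xi) - (1 : F2 k) ⊗ₜ[k] A 0)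
    (d₁ := iota k 0 (cubConst k z A xi zeta))
    (a₂ := 1) (b₂ := (yvar k ⊗ₜ[k] 1) * ((1 : F2 k) ⊗ₜ[k] xi) - (1 : F2 k) ⊗ₜ[k] A 0)
    (d₂ := iota k 1 (cubConst k z A xi zeta)) (w := (1 : F2 k) ⊗ₜ[k] ω)
    (A₀ := (1 : F2 k) ⊗ₜ[k] A 0) (A₁ := (1 : F2 k) ⊗ₜ[k] A 1) (A₂ := (1 : F2 k) ⊗ₜ[k] A 2)
    ?_ ?_ ?_ ?_ ?_ ?_ rfl ?_ ?_ rfl rfl rfl rfl rfl).trans ?_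
  · simp only [RingHom.id_apply, Algebra.TensorProduct.tmul_mul_tmul, one_mul, hs,
      Algebra.TensorProduct.one_def, ← TensorProduct.sub_tmul]
  · simp only [RingHom.id_apply, Algebra.TensorProduct.tmul_mul_tmul, one_mul, mul_one, hs]
  · simp only [RingHom.id_apply, Algebra.TensorProduct.tmul_mul_tmul, one_mul, mul_inv,
      Algebra.TensorProduct.one_def, ← TensorProduct.sub_tmul]
  · simp only [RingHom.id_apply, Algebra.TensorProduct.tmul_mul_tmul, one_mul, mul_one, mul_inv]
  · rw [map_one]; rfl
  · simp only [RingHom.id_apply, map_sub, iota_tmul, emb_X_zero, map_one,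
      Algebra.TensorProduct.tmul_mul_tmul, one_mul, mul_one]
  · rw [map_one]; rfl
  · simp only [RingHom.id_apply, map_sub, iota_tmul, emb_X_one, map_one,
      Algebra.TensorProduct.tmul_mul_tmul, one_mul, mul_one]
  · rw [h₁, h₂, h₃]
    exact zero_comb _ _ _

end Existence

section Necessity

variable [IsDomain z]

/-- The field `𝔷(x,y)`. -/
abbrev FracZ := FractionRing (MvPolynomial (Fin 2) z)

/-- The embedding `k[x,y] → 𝔷(x,y)`. -/
def polyFracMap : P2 k →ₐ[k] FracZ z :=
  (IsScalarTower.toAlgHom k (MvPolynomial (Fin 2) z) (FracZ z)).comp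
    (MvPolynomial.mapAlgHom (Algebra.ofId k z))

lemma polyFracMap_injective : Function.Injective (polyFracMap k z) :=
  (IsFractionRing.injective (MvPolynomial (Fin 2) z) (FracZ z)).comp
    (MvPolynomial.map_injective _ (algebraMap k z).injective)

/-- The embedding `k(x,y) → 𝔷(x,y)`. -/
def fracMap : F2 k →ₐ[k] FracZ z :=
  IsFractionRing.liftAlgHom (polyFracMap_injective k z)

lemma fracMap_algebraMap (P : P2 k) : fracMap k z (algebraMap (P2 k) (F2 k) P) =
    algebraMap (MvPolynomial (Fin 2) z) (FracZ z) (MvPolynomial.map (algebraMap k z) P) :=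
  IsFractionRing.lift_algebraMap (polyFracMap_injective k z) P

/-- The canonical map `k(x,y) ⊗ 𝔷 → 𝔷(x,y)`. -/
def scalFrac : F2 k ⊗[k] z →ₐ[k] FracZ z :=
  Algebra.TensorProduct.lift (fracMap k z) (IsScalarTower.toAlgHom k z (FracZ z))
    (fun _ _ => Commute.all _ _)

lemma scalFrac_tmul (r : F2 k) (a : z) :
    scalFrac k z (r ⊗ₜ[k] a) = fracMap k z r * algebraMap z (FracZ z) a := by
  simp [scalFrac]

/-- The representation of `H_p` on the module induced from the character `R ↦ q`, with scalars
extended to `𝔷(x,y)`. -/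
def indRep (q : k) (hq0 : q ≠ 0) (hω : ω = algebraMap k z (q - q⁻¹)) (A : ℕ → z) :
    Hp z ω 2 A →ₐ[z] Module.End (FracZ z) (Fin 9 → FracZ z) :=
  HpLift z ω A (indR (algebraMap k (FracZ z) q) (algebraMap k (FracZ z) q⁻¹))
    (indK (algebraMap z (FracZ z) (A 0)) (algebraMap z (FracZ z) (A 1))
      (algebraMap z (FracZ z) (A 2)))
    (by
      rw [indR_sq (by rw [← map_mul, mul_inv_cancel₀ hq0, map_one]), ← map_sub,
        IsScalarTower.algebraMap_apply k z (FracZ z), ← hω, algebraMap_smul])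
    (indR_indK _ _ _ _ _)
    (by
      rw [indK_cube, algebraMap_smul, algebraMap_smul, algebraMap_smul])

/-- The representation of `k(x,y) ⊗ H_p` extending `indRep`. -/
def indRepFrac (q : k) (hq0 : q ≠ 0) (hω : ω = algebraMap k z (q - q⁻¹)) (A : ℕ → z) :
    F2 k ⊗[k] Hp z ω 2 A →ₐ[k] Module.End (FracZ z) (Fin 9 → FracZ z) :=
  Algebra.TensorProduct.lift
    (((Algebra.ofId (FracZ z) (Module.End (FracZ z) (Fin 9 → FracZ z))).restrictScalars k).comp
      (fracMap k z))
    ((indRep k z ω q hq0 hω A).restrictScalars k)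
    (by intro r m; exact Algebra.commute_algebraMap_left (fracMap k z r) _)

lemma indRepFrac_tmul (q : k) (hq0 : q ≠ 0) (hω : ω = algebraMap k z (q - q⁻¹)) (A : ℕ → z)
    (r : F2 k) (m : Hp z ω 2 A) : indRepFrac k z ω q hq0 hω A (r ⊗ₜ[k] m) =
      algebraMap (FracZ z) _ (fracMap k z r) * indRep k z ω q hq0 hω A m :=
  Algebra.TensorProduct.lift_tmul _ _ _ _ _

lemma indRepFrac_scalT (q : k) (hq0 : q ≠ 0) (hω : ω = algebraMap k z (q - q⁻¹)) (A : ℕ → z)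
    (s : F2 k ⊗[k] z) : indRepFrac k z ω q hq0 hω A (scalT k z (F2 k) (Hp z ω 2 A) s) =
      algebraMap (FracZ z) _ (scalFrac k z s) := by
  induction s with
  | zero => simp
  | add a b ha hb => simp only [map_add, ha, hb]
  | tmul r a =>
    rw [scalT_tmul, scalFrac_tmul, indRepFrac_tmul, AlgHom.commutes, map_mul,
      ← IsScalarTower.algebraMap_apply]

/-- The coefficient equations satisfied by a solution `a K² + b K + d` of the spectral reflection
equation. -/
lemma IsSol.coeff_eq_zero (q : k) (hq0 : q ≠ 0) (hq1 : q ≠ 1) (hq1' : q ≠ -1)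
    (hω : ω = algebraMap k z (q - q⁻¹)) (A : ℕ → z) (a b d : RatFunc k ⊗[k] z)
    (hsol : IsSol k (q - q⁻¹) (Rp z ω 2 A) (quadT k z ω (RatFunc k) A a b d))
    {x y a₁ b₁ d₁ a₂ b₂ d₂ A₀ A₁ A₂ : FracZ z}
    (hx : fracMap k z (xvar k) = x) (hy : fracMap k z (yvar k) = y)
    (ha₁ : scalFrac k z (iota k 0 a) = a₁) (hb₁ : scalFrac k z (iota k 0 b) = b₁)
    (hd₁ : scalFrac k z (iota k 0 d) = d₁) (ha₂ : scalFrac k z (iota k 1 a) = a₂)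
    (hb₂ : scalFrac k z (iota k 1 b) = b₂) (hd₂ : scalFrac k z (iota k 1 d) = d₂)
    (hA₀ : algebraMap z (FracZ z) (A 0) = A₀) (hA₁ : algebraMap z (FracZ z) (A 1) = A₁)
    (hA₂ : algebraMap z (FracZ z) (A 2) = A₂) :
    ((1 - x⁻¹ * y) * (1 - x⁻¹ * y⁻¹) * (a₁ * a₂ * A₂ + d₁ * b₂) +
        (1 - x⁻¹ * y) * (x⁻¹ * y⁻¹) * (a₁ * a₂ * (A₀ * A₁ + A₂) + (a₁ * b₂ + b₁ * a₂) * A₁ +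
          b₁ * d₂ + d₁ * b₂) +
        x⁻¹ * y * (1 - x⁻¹ * y⁻¹) * (d₁ * b₂ - b₁ * d₂) = 0) ∧
      ((1 - x⁻¹ * y) * (1 - x⁻¹ * y⁻¹) * (d₁ * a₂) +
        (1 - x⁻¹ * y) * (x⁻¹ * y⁻¹) * (a₁ * a₂ * (A₀ ^ 2 + A₁) + (a₁ * b₂ + b₁ * a₂) * A₀ +
          a₁ * d₂ + b₁ * b₂ + d₁ * a₂) +
        x⁻¹ * y * (1 - x⁻¹ * y⁻¹) * (d₁ * a₂ - a₁ * d₂) = 0) ∧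
      (-((1 - x⁻¹ * y) * (1 - x⁻¹ * y⁻¹) * a₁ * (A₀ * a₂ + b₂)) +
        x⁻¹ * y * (1 - x⁻¹ * y⁻¹) * (b₁ * a₂ - a₁ * b₂) = 0) := by
  have hw0 : q - q⁻¹ ≠ 0 := by
    intro h
    have h2 : (q - 1) * (q + 1) = 0 := by
      have := mul_inv_cancel₀ hq0
      linear_combination q * h + this
    rcases mul_eq_zero.mp h2 with h | h
    · exact hq1 (sub_eq_zero.mp h)
    · exact hq1' (eq_neg_of_add_eq_zero_left h)
  have hwL : algebraMap z (FracZ z) ω ≠ 0 := by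
    rw [hω, ← IsScalarTower.algebraMap_apply]
    exact (map_ne_zero _).mpr hw0
  have key := spectral_defect k z ω (S := FracZ z) (E := Module.End (FracZ z) (Fin 9 → FracZ z))
    (q - q⁻¹) hω A (scalFrac k z).toRingHom (indRepFrac k z ω q hq0 hω A).toRingHom
    (indRepFrac_scalT k z ω q hq0 hω A)
    (R := indR (algebraMap k (FracZ z) q) (algebraMap k (FracZ z) q⁻¹))
    (K := indK A₀ A₁ A₂) (by
      refine (indRepFrac_tmul k z ω q hq0 hω A _ _).trans ?_
      rw [map_one, map_one, one_mul]
      exact HpLift_Rp _ _ _ _ _ _ _ _) (by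
      subst hA₀ hA₁ hA₂
      refine (indRepFrac_tmul k z ω q hq0 hω A _ _).trans ?_
      rw [map_one, map_one, one_mul]
      exact HpLift_Kp _ _ _ _ _ _ _ _)
    (xvar k / yvar k) (xvar k * yvar k) _ _ _ _ _ _
    (α := 1 - x⁻¹ * y) (β := x⁻¹ * y * algebraMap z (FracZ z) ω)
    (γ := 1 - x⁻¹ * y⁻¹) (δ := x⁻¹ * y⁻¹ * algebraMap z (FracZ z) ω)
    (w := algebraMap z (FracZ z) ω) (A₀ := A₀) (A₁ := A₁) (A₂ := A₂)
    (by
      refine (scalFrac_tmul k z _ _).trans ?_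
      rw [map_one, mul_one, inv_div, map_sub, map_one, map_div₀, hx, hy, div_eq_mul_inv, mul_comm])
    (by
      refine (scalFrac_tmul k z _ _).trans ?_
      rw [inv_div, map_div₀, hx, hy, div_eq_mul_inv, mul_comm y])
    (by
      refine (scalFrac_tmul k z _ _).trans ?_
      rw [map_one, mul_one, mul_inv, map_sub, map_one, map_mul, map_inv₀, map_inv₀, hx, hy])
    (by
      refine (scalFrac_tmul k z _ _).trans ?_
      rw [mul_inv, map_mul, map_inv₀, map_inv₀, hx, hy])
    ha₁ hb₁ hd₁ ha₂ hb₂ hd₂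
    ((scalFrac_tmul k z _ _).trans (by rw [map_one, one_mul]))
    ((scalFrac_tmul k z _ _).trans (by rw [map_one, one_mul, hA₀]))
    ((scalFrac_tmul k z _ _).trans (by rw [map_one, one_mul, hA₁]))
    ((scalFrac_tmul k z _ _).trans (by rw [map_one, one_mul, hA₂]))
  rw [IsSol, iota_quadT, iota_quadT, ← sub_eq_zero] at hsol
  rw [hsol, map_zero] at key
  obtain ⟨h₁, h₂, h₃⟩ := ind_antisymm_independent
    (by rw [← map_mul, mul_inv_cancel₀ hq0, map_one]) A₀ A₁ A₂ key.symm
  refine ⟨mul_left_cancel₀ hwL ?_, mul_left_cancel₀ hwL ?_, mul_left_cancel₀ hwL ?_⟩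
  · linear_combination h₁
  · linear_combination h₂
  · linear_combination h₃

end Necessity
section CoefficientEquations

variable {F : Type} [Field F] {x y a a' b b' d d' ξ A₀ A₁ A₂ : F}

lemma linear_coeff_relation (hx : x ≠ 0) (hy : y ≠ 0) (hxy : x * y ≠ 1)
    (h : -((1 - x⁻¹ * y) * (1 - x⁻¹ * y⁻¹) * a * (A₀ * a' + b')) +
        x⁻¹ * y * (1 - x⁻¹ * y⁻¹) * (b * a' - a * b') = 0) :
    (b + A₀ * a) * (y * a') = x * a * (b' + A₀ * a') := by
  have h0 : x * y - 1 ≠ 0 := sub_ne_zero.mpr hxy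
  refine mul_left_cancel₀ h0 ?_
  field_simp at h
  grind

lemma const_coeff_relation (hx : x ≠ 0) (hy : y ≠ 0)
    (hb : b = ξ * x * a - A₀ * a) (hb' : b' = ξ * y * a' - A₀ * a')
    (h : (1 - x⁻¹ * y) * (1 - x⁻¹ * y⁻¹) * (d * a') +
        (1 - x⁻¹ * y) * (x⁻¹ * y⁻¹) * (a * a' * (A₀ ^ 2 + A₁) + (a * b' + b * a') * A₀ +
          a * d' + b * b' + d * a') +
        x⁻¹ * y * (1 - x⁻¹ * y⁻¹) * (d * a' - a * d') = 0) :
    ((x ^ 2 - 1) * d - A₁ * a + ξ ^ 2 * x ^ 2 * a) * (y * a') =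
      x * a * ((y ^ 2 - 1) * d' - A₁ * a' + ξ ^ 2 * y ^ 2 * a') := by
  subst hb hb'
  field_simp at h
  grind

lemma parameter_relation {ζ : F} (hx : x ≠ 0) (hy : y ≠ 0) (hxy : x * y ≠ 1) (hne : x ≠ y)
    (hx2 : x ^ 2 ≠ 1) (hy2 : y ^ 2 ≠ 1) (ha : a ≠ 0) (ha' : a' ≠ 0)
    (hb : b = ξ * x * a - A₀ * a) (hb' : b' = ξ * y * a' - A₀ * a')
    (hd : (x ^ 2 - 1) * d - A₁ * a + ξ ^ 2 * x ^ 2 * a = (ζ + A₀ * ξ) * (x * a))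
    (hd' : (y ^ 2 - 1) * d' - A₁ * a' + ξ ^ 2 * y ^ 2 * a' = (ζ + A₀ * ξ) * (y * a'))
    (h : (1 - x⁻¹ * y) * (1 - x⁻¹ * y⁻¹) * (a * a' * A₂ + d * b') +
        (1 - x⁻¹ * y) * (x⁻¹ * y⁻¹) * (a * a' * (A₀ * A₁ + A₂) + (a * b' + b * a') * A₁ +
          b * d' + d * b') +
        x⁻¹ * y * (1 - x⁻¹ * y⁻¹) * (d * b' - b * d') = 0) :
    ζ * ξ = A₂ := by
  have h1 : x - y ≠ 0 := sub_ne_zero.mpr hne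
  have h2 : x ^ 2 - 1 ≠ 0 := sub_ne_zero.mpr hx2
  have h3 : y ^ 2 - 1 ≠ 0 := sub_ne_zero.mpr hy2
  obtain ⟨e, rfl⟩ : ∃ e, d = e * a := ⟨d / a, by field_simp⟩
  obtain ⟨e', rfl⟩ : ∃ e, d' = e * a' := ⟨d' / a', by field_simp⟩
  have hd1 : e = ((ζ + A₀ * ξ) * x - ξ ^ 2 * x ^ 2 + A₁) / (x ^ 2 - 1) := by
    rw [eq_div_iff h2]
    refine mul_right_cancel₀ ha ?_
    linear_combination hd
  have hd1' : e' = ((ζ + A₀ * ξ) * y - ξ ^ 2 * y ^ 2 + A₁) / (y ^ 2 - 1) := by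
    rw [eq_div_iff h3]
    refine mul_right_cancel₀ ha' ?_
    linear_combination hd'
  subst hb hb' hd1 hd1'
  have h4 : (x - y) * (ζ * ξ - A₂) = 0 := by
    field_simp at h
    grind
  exact sub_eq_zero.mp ((mul_eq_zero.mp h4).resolve_left h1)

end CoefficientEquations
section PolynomialCoefficients

open Polynomial

/-- The canonical map `𝔷[u] → k(x) ⊗ 𝔷`. -/
def polyT : z[X] →+* RatFunc k ⊗[k] z :=
  eval₂RingHom (Algebra.TensorProduct.includeRight : z →ₐ[k] RatFunc k ⊗[k] z).toRingHom
    (RatFunc.X ⊗ₜ[k] 1)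

lemma polyT_C (a : z) : polyT k z (C a) = (1 : RatFunc k) ⊗ₜ[k] a := by
  simp [polyT]

lemma polyT_X : polyT k z X = (RatFunc.X : RatFunc k) ⊗ₜ[k] 1 := by
  simp [polyT]

lemma polyT_map (p : k[X]) :
    polyT k z (p.map (algebraMap k z)) = algebraMap k[X] (RatFunc k) p ⊗ₜ[k] 1 := by
  have h : (polyT k z).comp (mapRingHom (algebraMap k z)) =
      (Algebra.TensorProduct.includeLeftRingHom : RatFunc k →+* RatFunc k ⊗[k] z).comp
        (algebraMap k[X] (RatFunc k)) := by
    ext a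
    · simp only [RingHom.comp_apply, coe_mapRingHom, map_C, polyT_C]
      rw [Algebra.algebraMap_eq_smul_one, TensorProduct.tmul_smul, TensorProduct.smul_tmul',
        RatFunc.algebraMap_C, Algebra.smul_def, mul_one]
      rfl
    · simp [polyT_X, RatFunc.algebraMap_X]
  exact congrArg (fun f => f p) h

lemma polyT_map_mul (p : k[X]) (P : z[X]) : polyT k z (p.map (algebraMap k z) * P) =
    algebraMap k[X] (RatFunc k) p • polyT k z P := by
  rw [map_mul, polyT_map, Algebra.smul_def]
  rfl

lemma exists_smul_eq_polyT (a : RatFunc k ⊗[k] z) :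
    ∃ s : k[X], s ≠ 0 ∧ ∃ P : z[X], algebraMap k[X] (RatFunc k) s • a = polyT k z P := by
  induction a with
  | zero => exact ⟨1, one_ne_zero, 0, by simp⟩
  | add a b ha hb =>
    obtain ⟨s, hs, P, hP⟩ := ha
    obtain ⟨t, ht, Q, hQ⟩ := hb
    refine ⟨s * t, mul_ne_zero hs ht,
      t.map (algebraMap k z) * P + s.map (algebraMap k z) * Q, ?_⟩
    rw [map_add, polyT_map_mul, polyT_map_mul, ← hP, ← hQ, map_mul, smul_add, smul_smul,
      smul_smul, mul_comm]
  | tmul r a =>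
    refine ⟨r.denom, r.denom_ne_zero, r.num.map (algebraMap k z) * C a, ?_⟩
    have h : algebraMap k[X] (RatFunc k) r.denom * r = algebraMap k[X] (RatFunc k) r.num := by
      nth_rewrite 2 [← r.num_div_denom]
      rw [mul_div_cancel₀]
      simpa using r.denom_ne_zero
    rw [polyT_map_mul, polyT_C, TensorProduct.smul_tmul', TensorProduct.smul_tmul', smul_eq_mul,
      smul_eq_mul, h, mul_one]

lemma quad_mul_quad {S E : Type} [CommRing S] [Ring E] [Algebra S E] {K : E} {A₀ A₁ A₂ : S}
    (hK : K ^ 3 = A₀ • K ^ 2 + A₁ • K + A₂ • 1) (a b d a' b' d' : S) :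
    ∃ a'' b'' d'' : S, (a • K ^ 2 + b • K + d • 1) * (a' • K ^ 2 + b' • K + d' • 1) =
      a'' • K ^ 2 + b'' • K + d'' • 1 := by
  have hK4 : K ^ 4 = A₀ • (A₀ • K ^ 2 + A₁ • K + A₂ • 1) + A₁ • K ^ 2 + A₂ • K := by
    rw [pow_succ, ← hK, hK]
    simp only [add_mul, smul_mul_assoc, one_mul, ← pow_succ, ← pow_two, hK]
  have h1 : K * K = K ^ 2 := (pow_two K).symm
  have h2 : K ^ 2 * K = K ^ 3 := (pow_succ K 2).symm
  have h3 : K * K ^ 2 = K ^ 3 := (pow_succ' K 2).symm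
  have h4 : K ^ 2 * K ^ 2 = K ^ 4 := (pow_add K 2 2).symm
  refine ⟨a * d' + b * b' + d * a' + (a * b' + b * a') * A₀ + a * a' * (A₀ ^ 2 + A₁),
    b * d' + d * b' + (a * b' + b * a') * A₁ + a * a' * (A₀ * A₁ + A₂),
    d * d' + (a * b' + b * a') * A₂ + a * a' * (A₀ * A₂), ?_⟩
  simp only [add_mul, mul_add, smul_mul_smul_comm, one_mul, mul_one, h1, h2, h3, h4, hK4]
  rw [hK]
  module

lemma exists_eq_quadT (A : ℕ → z) {c : RatFunc k ⊗[k] Hp z ω 2 A} (hc : c ∈ KpX k z ω 2 A) :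
    ∃ a b d, c = quadT k z ω (RatFunc k) A a b d := by
  induction hc using Algebra.adjoin_induction with
  | mem c hc =>
    rcases hc with hc | ⟨a, rfl⟩
    · rw [Set.mem_singleton_iff] at hc
      exact ⟨0, 1, 0, by simp [quadT, hc]⟩
    · exact ⟨0, 0, (1 : RatFunc k) ⊗ₜ[k] a, by simp [quadT, scalT_tmul]⟩
  | algebraMap r => exact ⟨0, 0, algebraMap _ _ r, by simp [quadT, scalT_tmul]⟩
  | add c c' _ _ hc hc' =>
    obtain ⟨a, b, d, rfl⟩ := hc
    obtain ⟨a', b', d', rfl⟩ := hc'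
    refine ⟨a + a', b + b', d + d', ?_⟩
    simp only [quadT, map_add, add_mul]
    abel
  | mul c c' _ _ hc hc' =>
    obtain ⟨a, b, d, rfl⟩ := hc
    obtain ⟨a', b', d', rfl⟩ := hc'
    let := scalAlgebra k z (RatFunc k) (Hp z ω 2 A)
    have hs (s : RatFunc k ⊗[k] z) (m : RatFunc k ⊗[k] Hp z ω 2 A) :
        scalT k z (RatFunc k) (Hp z ω 2 A) s * m = s • m := rfl
    have hq (a b d : RatFunc k ⊗[k] z) : quadT k z ω (RatFunc k) A a b d =
        a • ((1 : RatFunc k) ⊗ₜ[k] Kp z ω 2 A) ^ 2 + b • ((1 : RatFunc k) ⊗ₜ[k] Kp z ω 2 A) +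
          d • 1 := by
      simp only [quadT, ← hs, mul_one]
    have hK : ((1 : RatFunc k) ⊗ₜ[k] Kp z ω 2 A) ^ 3 =
        ((1 : RatFunc k) ⊗ₜ[k] A 0) • ((1 : RatFunc k) ⊗ₜ[k] Kp z ω 2 A) ^ 2 +
          ((1 : RatFunc k) ⊗ₜ[k] A 1) • ((1 : RatFunc k) ⊗ₜ[k] Kp z ω 2 A) +
          ((1 : RatFunc k) ⊗ₜ[k] A 2) • 1 := by
      simp only [← hs, scalT_tmul, Algebra.TensorProduct.tmul_pow, one_pow,
        Algebra.TensorProduct.tmul_mul_tmul, mul_one, Kp_cube, TensorProduct.tmul_add,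
        Algebra.smul_def]
    simp only [hq]
    exact quad_mul_quad hK a b d a' b' d'

lemma smul_quadT (F : Type) [Field F] [Algebra k F] (A : ℕ → z) (r : F) (a b d : F ⊗[k] z) :
    r • quadT k z ω F A a b d = quadT k z ω F A (r • a) (r • b) (r • d) := by
  simp only [quadT, map_smul, smul_add, smul_mul_assoc]

lemma exists_smul_eq_quadT (A : ℕ → z) {c : RatFunc k ⊗[k] Hp z ω 2 A}
    (hc : c ∈ KpX k z ω 2 A) : ∃ s : k[X], s ≠ 0 ∧ ∃ P Q D : z[X],
      algebraMap k[X] (RatFunc k) s • c =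
        quadT k z ω (RatFunc k) A (polyT k z P) (polyT k z Q) (polyT k z D) := by
  obtain ⟨a, b, d, rfl⟩ := exists_eq_quadT k z ω A hc
  obtain ⟨s, hs, P, hP⟩ := exists_smul_eq_polyT k z a
  obtain ⟨t, ht, Q, hQ⟩ := exists_smul_eq_polyT k z b
  obtain ⟨u, hu, D, hD⟩ := exists_smul_eq_polyT k z d
  refine ⟨s * t * u, mul_ne_zero (mul_ne_zero hs ht) hu, (t * u).map (algebraMap k z) * P,
    (s * u).map (algebraMap k z) * Q, (s * t).map (algebraMap k z) * D, ?_⟩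
  rw [polyT_map_mul, polyT_map_mul, polyT_map_mul, ← hP, ← hQ, ← hD, smul_quadT, smul_smul,
    smul_smul, smul_smul, ← map_mul, ← map_mul, ← map_mul]
  congr 3 <;> ring

lemma IsSol.smul {B : Type} [Ring B] [Algebra k B] {ωk : k} {R : B} {c : RatFunc k ⊗[k] B}
    (h : IsSol k ωk R c) (r : RatFunc k) : IsSol k ωk R (r • c) := by
  have hi (i : Fin 2) (c : RatFunc k ⊗[k] B) : iota k i (r • c) = emb k i r • iota k i c := by
    induction c with
    | zero => simp
    | add c c' hc hc' => rw [smul_add, map_add, hc, hc', map_add, smul_add]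
    | tmul t b =>
      rw [TensorProduct.smul_tmul', iota, Algebra.TensorProduct.map_tmul,
        Algebra.TensorProduct.map_tmul, TensorProduct.smul_tmul', smul_eq_mul, smul_eq_mul, map_mul]
  rw [IsSol] at h ⊢
  simp only [hi, smul_mul_assoc, mul_smul_comm, h]
  rw [smul_comm]

lemma exists_eq_C_mul_of_proportional (hz : IsField z) {H P : z[X]} (hP : P ≠ 0)
    (h : evP z 0 H * evP z 1 P = evP z 0 P * evP z 1 H) : ∃ a : z, H = C a * P := by
  have := hz.isDomain
  let f : MvPolynomial (Fin 2) z →ₐ[z] z[X][X] := MvPolynomial.aeval ![C X, X]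
  have h0 (Q : z[X]) : f (evP z 0 Q) = C Q := by
    have : (f.comp (evP z 0)) = IsScalarTower.toAlgHom z z[X] z[X][X] := by
      ext; simp [f, evP]
    exact congrArg (fun g => g Q) this
  have h1 (Q : z[X]) : f (evP z 1 Q) = Q.map C := by
    have : (f.comp (evP z 1)) = mapAlgHom (Algebra.ofId z z[X]) := by
      ext; simp [f, evP]
    exact congrArg (fun g => g Q) this
  have h2 := congrArg (fun Q => (f Q).coeff P.natDegree) h
  simp only [map_mul, h0, h1, coeff_C_mul, coeff_map] at h2
  obtain ⟨l, hl⟩ := hz.mul_inv_cancel (leadingCoeff_ne_zero.mpr hP)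
  refine ⟨H.coeff P.natDegree * l, ?_⟩
  have h3 : C (P.coeff P.natDegree) * C l = 1 := by
    rw [← C_mul, ← C_1]; exact congrArg C hl
  rw [C_mul]
  linear_combination C l * h2 - H * h3

end PolynomialCoefficients
section Classification

open Polynomial

/-- The map `𝔷[u] → 𝔷(x,y)` sending `u` to the `i`-th variable. -/
def evFrac (i : Fin 2) : z[X] →ₐ[z] FracZ z :=
  (IsScalarTower.toAlgHom z (MvPolynomial (Fin 2) z) (FracZ z)).comp (evP z i)

lemma evFrac_apply (i : Fin 2) (P : z[X]) :
    evFrac z i P = algebraMap (MvPolynomial (Fin 2) z) (FracZ z) (evP z i P) := rfl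

lemma evFrac_C (i : Fin 2) (a : z) : evFrac z i (C a) = algebraMap z (FracZ z) a :=
  (evFrac z i).commutes a

lemma evFrac_X (i : Fin 2) : evFrac z i X =
    algebraMap (MvPolynomial (Fin 2) z) (FracZ z) (MvPolynomial.X i) := by
  rw [evFrac_apply, evP, aeval_X]

lemma evFrac_injective (i : Fin 2) : Function.Injective (evFrac z i) := by
  refine (IsFractionRing.injective (MvPolynomial (Fin 2) z) (FracZ z)).comp
    (Function.LeftInverse.injective (g := MvPolynomial.aeval (fun _ => X)) ?_)
  intro P
  have h : (MvPolynomial.aeval (R := z) (fun _ : Fin 2 => (X : z[X]))).comp (evP z i) =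
      AlgHom.id z z[X] := by
    ext; simp [evP]
  exact congrArg (fun g => g P) h

lemma quadT_eq_scalT_mul_Kcub (A : ℕ → z) (ξ ζ : z) {P Q D : z[X]}
    (hQ : Q = (C ξ * X - C (A 0)) * P)
    (hD : (X ^ 2 - 1) * D =
      (C ζ * X + C (A 0 * ξ) * X + C (A 1) - C (ξ ^ 2) * X ^ 2) * P) :
    quadT k z ω (RatFunc k) A (polyT k z P) (polyT k z Q) (polyT k z D) =
      scalT k z (RatFunc k) (Hp z ω 2 A) (polyT k z P) * Kcub k z ω A ξ ζ := by
  have hQ' : polyT k z Q = polyT k z P *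
      ((RatFunc.X : RatFunc k) ⊗ₜ[k] ξ - (1 : RatFunc k) ⊗ₜ[k] A 0) := by
    rw [hQ, map_mul, map_sub, map_mul, polyT_C, polyT_C, polyT_X,
      Algebra.TensorProduct.tmul_mul_tmul, one_mul, mul_one, mul_comm]
  have hXX : (RatFunc.X ⊗ₜ[k] 1 : RatFunc k ⊗[k] z) * ((RatFunc.X)⁻¹ ⊗ₜ[k] 1) = 1 := by
    rw [Algebra.TensorProduct.tmul_mul_tmul, mul_inv_cancel₀ RatFunc.X_ne_zero, one_mul]; rfl
  have hXi : ((RatFunc.X - RatFunc.X⁻¹ : RatFunc k)⁻¹ ⊗ₜ[k] 1 : RatFunc k ⊗[k] z) *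
      (RatFunc.X ⊗ₜ[k] 1 - RatFunc.X⁻¹ ⊗ₜ[k] 1) = 1 := by
    rw [← TensorProduct.sub_tmul, Algebra.TensorProduct.tmul_mul_tmul,
      inv_mul_cancel₀ (ratFunc_X_sub_inv_ne_zero k), one_mul]; rfl
  have hD' : polyT k z D = polyT k z P * cubConst k z A ξ ζ := by
    have h1 := congrArg (polyT k z) hD
    have h2 := X_sub_inv_mul_cubConst k z A ξ ζ
    simp only [map_mul, map_sub, map_add, map_pow, map_one, polyT_C, polyT_X] at h1
    generalize ((RatFunc.X - RatFunc.X⁻¹ : RatFunc k)⁻¹ ⊗ₜ[k] 1 : RatFunc k ⊗[k] z) = v at hXi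
    grind
  simp only [Kcub_eq, quadT, hQ', hD', map_mul, map_one, mul_add, one_mul, mul_assoc]

lemma exists_eq_C_mul_of_evFrac (hz : IsField z) {H P : z[X]} (hP : P ≠ 0)
    (h : evFrac z 0 H * evFrac z 1 P = evFrac z 0 P * evFrac z 1 H) : ∃ a : z, H = C a * P := by
  refine exists_eq_C_mul_of_proportional z hz hP
    (IsFractionRing.injective (MvPolynomial (Fin 2) z) (FracZ z) ?_)
  simpa only [map_mul, evFrac_apply] using h

variable [IsDomain z]

lemma fracMap_xvar : fracMap k z (xvar k) = evFrac z 0 X := by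
  rw [xvar, fracMap_algebraMap, MvPolynomial.map_X, evFrac_X]

lemma fracMap_yvar : fracMap k z (yvar k) = evFrac z 1 X := by
  rw [yvar, fracMap_algebraMap, MvPolynomial.map_X, evFrac_X]

lemma scalFrac_iota_polyT (i : Fin 2) (P : z[X]) :
    scalFrac k z (iota k i (polyT k z P)) = evFrac z i P := by
  have h : ((scalFrac k z).toRingHom.comp (iota k i).toRingHom).comp (polyT k z) =
      (evFrac z i).toRingHom := by
    refine ringHom_ext (fun a => ?_) ?_
    · change scalFrac k z (iota k i (polyT k z (C a))) = evFrac z i (C a)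
      rw [polyT_C, iota_tmul, scalFrac_tmul, map_one, map_one, one_mul, evFrac_C]
    · change scalFrac k z (iota k i (polyT k z X)) = evFrac z i X
      rw [polyT_X, iota_tmul, scalFrac_tmul, map_one, mul_one]
      fin_cases i
      · exact (congrArg _ (emb_X_zero k)).trans (fracMap_xvar k z)
      · exact (congrArg _ (emb_X_one k)).trans (fracMap_yvar k z)
  exact congrArg (fun f => f P) h

/-- The coefficients of a solution with coefficients in `𝔷[x]` are either constant, or satisfy the
relations characterizing the cubic baxterized elements. -/
lemma IsSol.polynomial_coeff (hz : IsField z) (q : k) (hq0 : q ≠ 0) (hq1 : q ≠ 1) (hq1' : q ≠ -1)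
    (hω : ω = algebraMap k z (q - q⁻¹)) (A : ℕ → z) (P Q D : z[X])
    (hsol : IsSol k (q - q⁻¹) (Rp z ω 2 A)
      (quadT k z ω (RatFunc k) A (polyT k z P) (polyT k z Q) (polyT k z D))) :
    (P = 0 ∧ Q = 0) ∨ ∃ ξ ζ : z, ζ * ξ = A 2 ∧ Q = (C ξ * X - C (A 0)) * P ∧
      (X ^ 2 - 1) * D = (C ζ * X + C (A 0 * ξ) * X + C (A 1) - C (ξ ^ 2) * X ^ 2) * P := by
  obtain ⟨h₁, h₂, h₃⟩ := hsol.coeff_eq_zero k z ω q hq0 hq1 hq1' hω A _ _ _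
    (fracMap_xvar k z) (fracMap_yvar k z) (scalFrac_iota_polyT k z 0 P)
    (scalFrac_iota_polyT k z 0 Q) (scalFrac_iota_polyT k z 0 D) (scalFrac_iota_polyT k z 1 P)
    (scalFrac_iota_polyT k z 1 Q) (scalFrac_iota_polyT k z 1 D) rfl rfl rfl
  have inj := IsFractionRing.injective (MvPolynomial (Fin 2) z) (FracZ z)
  have hx : evFrac z 0 X ≠ 0 := (map_ne_zero_iff _ (evFrac_injective z 0)).mpr X_ne_zero
  have hy : evFrac z 1 X ≠ 0 := (map_ne_zero_iff _ (evFrac_injective z 1)).mpr X_ne_zero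
  have hne : evFrac z 0 X ≠ evFrac z 1 X := by
    rw [evFrac_X, evFrac_X, inj.ne_iff]
    exact MvPolynomial.X_injective.ne (by decide)
  have hxy : evFrac z 0 X * evFrac z 1 X ≠ 1 := by
    rw [evFrac_X, evFrac_X, ← map_mul, ← map_one (algebraMap (MvPolynomial (Fin 2) z) (FracZ z)),
      inj.ne_iff]
    intro h
    have := congrArg (MvPolynomial.eval (fun _ => (0 : z))) h
    simp at this
  have hX2 : (X ^ 2 - 1 : z[X]) ≠ 0 := X_pow_sub_C_ne_zero (by norm_num) (1 : z)
  have hx2 (i : Fin 2) : evFrac z i X ^ 2 ≠ 1 := by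
    rw [← map_pow, ← map_one (evFrac z i), (evFrac_injective z i).ne_iff]
    exact sub_ne_zero.mp hX2
  by_cases hP : P = 0
  · left
    refine ⟨hP, ?_⟩
    subst hP
    simp only [map_zero, mul_zero, zero_mul, add_zero, zero_add, sub_zero] at h₂
    by_contra hQ
    have hQi (i : Fin 2) : evFrac z i Q ≠ 0 := (map_ne_zero_iff _ (evFrac_injective z i)).mpr hQ
    refine mul_ne_zero (mul_ne_zero ?_ (mul_ne_zero (inv_ne_zero hx) (inv_ne_zero hy)))
      (mul_ne_zero (hQi 0) (hQi 1)) h₂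
    rw [sub_ne_zero]
    intro h
    apply hne
    field_simp at h
    exact h
  right
  have hPi (i : Fin 2) : evFrac z i P ≠ 0 := (map_ne_zero_iff _ (evFrac_injective z i)).mpr hP
  obtain ⟨ξ, hξ⟩ := exists_eq_C_mul_of_evFrac z hz (H := Q + C (A 0) * P) (P := X * P)
    (mul_ne_zero X_ne_zero hP) (by
      simp only [map_add, map_mul, evFrac_C]
      exact linear_coeff_relation hx hy hxy h₃)
  have hQ : Q = (C ξ * X - C (A 0)) * P := by linear_combination hξ
  have hQi (i : Fin 2) : evFrac z i Q = algebraMap z (FracZ z) ξ * evFrac z i X * evFrac z i P -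
      algebraMap z (FracZ z) (A 0) * evFrac z i P := by
    rw [hQ, map_mul, map_sub, map_mul, evFrac_C, evFrac_C, sub_mul]
  obtain ⟨η, hη⟩ := exists_eq_C_mul_of_evFrac z hz
    (H := (X ^ 2 - 1) * D - C (A 1) * P + C ξ ^ 2 * X ^ 2 * P) (P := X * P)
    (mul_ne_zero X_ne_zero hP) (by
      simp only [map_add, map_sub, map_mul, map_pow, map_one, evFrac_C]
      exact const_coeff_relation hx hy (hQi 0) (hQi 1) h₂)
  have hη' : (X ^ 2 - 1) * D - C (A 1) * P + C ξ ^ 2 * X ^ 2 * P =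
      (C (η - A 0 * ξ) + C (A 0) * C ξ) * (X * P) := by
    rw [hη, C_sub, C_mul, sub_add_cancel]
  have hDi (i : Fin 2) := congrArg (evFrac z i) hη'
  simp only [map_add, map_mul, evFrac_C] at hDi
  refine ⟨ξ, η - A 0 * ξ, ?_, hQ, ?_⟩
  · apply FaithfulSMul.algebraMap_injective z (FracZ z)
    rw [map_mul]
    refine parameter_relation hx hy hxy hne (hx2 0) (hx2 1) (hPi 0) (hPi 1) (hQi 0) (hQi 1)
      (d := evFrac z 0 D) (d' := evFrac z 1 D) ?_ ?_ h₁
    · simpa only [map_add, map_sub, map_mul, map_pow, map_one, evFrac_C] using hDi 0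
    · simpa only [map_add, map_sub, map_mul, map_pow, map_one, evFrac_C] using hDi 1
  · rw [C_mul, C_pow]
    linear_combination hη'

lemma IsSol.eq_mul_Kcub (hz : IsField z) (q : k) (hq0 : q ≠ 0) (hq1 : q ≠ 1) (hq1' : q ≠ -1)
    (hω : ω = algebraMap k z (q - q⁻¹)) (A : ℕ → z) {c : RatFunc k ⊗[k] Hp z ω 2 A}
    (hc : c ∈ KpX k z ω 2 A) (hsol : IsSol k (q - q⁻¹) (Rp z ω 2 A) c)
    (hns : ¬ IsScalarElt k z c) :
    ∃ f : RatFunc k ⊗[k] Hp z ω 2 A, IsScalarElt k z f ∧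
      ∃ ξ ζ : z, ζ * ξ = A 2 ∧ c = f * Kcub k z ω A ξ ζ := by
  obtain ⟨s, hs, P, Q, D, hsc⟩ := exists_smul_eq_quadT k z ω A hc
  have hs' : algebraMap k[X] (RatFunc k) s ≠ 0 := RatFunc.algebraMap_ne_zero hs
  have hsol' := hsol.smul k (algebraMap k[X] (RatFunc k) s)
  rw [hsc] at hsol'
  rw [← eq_inv_smul_iff₀ hs'] at hsc
  rcases hsol'.polynomial_coeff k z ω hz q hq0 hq1 hq1' hω A P Q D with
    ⟨rfl, rfl⟩ | ⟨ξ, ζ, hA, hQ, hD⟩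
  · refine absurd ?_ hns
    rw [hsc, quadT, map_zero, map_zero, zero_mul, zero_mul, zero_add, zero_add]
    exact Submodule.smul_mem _ _ (isScalarElt_scalT k z _ _)
  · refine ⟨_, Submodule.smul_mem _ (algebraMap k[X] (RatFunc k) s)⁻¹
      (isScalarElt_scalT k z _ (polyT k z P)), ξ, ζ, hA, ?_⟩
    rw [hsc, quadT_eq_scalT_mul_Kcub k z ω A ξ ζ hQ hD, smul_mul_assoc]

end Classification

/-- cubic case, n = 2, K³ = A₀K² + A₁K + A₂: for every ξ, ζ ∈ 𝔷 with
ζξ = A₂, K(x) = K² + (ξx − A₀)K + (ζ − x⁻¹(x²ξ² − A₀ξx − A₁))/(x − x⁻¹) solves the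
reflection equation with spectral parameter, and if 𝔷 is a field every non-trivial solution
is of this form up to a factor from 𝔷(x). -/
theorem baxterization_cubic [CharZero k]
    (q : k) (hq0 : q ≠ 0) (hq1 : q ≠ 1) (hq1' : q ≠ -1)
    (hω : ω = algebraMap k z (q - q⁻¹)) (A : ℕ → z) :
    (∀ xi zeta : z, zeta * xi = A 2 →
        IsSol k (q - q⁻¹) (Rp z ω 2 A) (Kcub k z ω A xi zeta)) ∧
      (IsField z → ∀ c ∈ KpX k z ω 2 A,
        IsSol k (q - q⁻¹) (Rp z ω 2 A) c → ¬ IsScalarElt k z c →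
        ∃ f : RatFunc k ⊗[k] Hp z ω 2 A, IsScalarElt k z f ∧
          ∃ xi zeta : z, zeta * xi = A 2 ∧ c = f * Kcub k z ω A xi zeta) := by
  exact ⟨fun xi zeta hA => isSol_Kcub k z ω (q - q⁻¹) hω A xi zeta hA,
    fun hz c hc hsol hns =>
      have := hz.isDomain
      hsol.eq_mul_Kcub k z ω hz q hq0 hq1 hq1' hω A hc hns⟩

end Baxterization
end
end

section
/- Let i and m be integers with 0 ≤ i ≤ m ≤ n, and let ξ ∈ 𝔷. Writing φ'_α = φ_α(ξ,x), φ''_α = φ_α(ξ,y) (as polynomials in 𝔷[x,y]) and Δ_α = φ'_α − φ''_α, the following identity holds in 𝔷[x,y]: ξ(x − y) Σ_{α=i}^{m} φ'_α φ''_{m+i−α} = φ'_{m+1} φ''_i − φ'_i φ''_{m+1} − Σ_{α=i}^{m} A_α Δ_{m+i−α}. -/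
noncomputable section
namespace Baxterization
open scoped TensorProduct

/-! ## The affine Hecke algebra of rank one -/

variable (k : Type) [Field k]
variable (z : Type) [CommRing z] [Algebra k z]

variable (ω : z)

variable {B : Type} [Ring B] [Algebra k B]

variable [Algebra z B]

/-- Christoffel–Darboux type summation for two sequences satisfying the first order recurrences
`a (j + 1) = a j * s - c j` and `b (j + 1) = b j * t - c j`. -/
theorem sum_mul_of_recurrence {R : Type*} [CommRing R] {a b c : ℕ → R} {s t : R}
    (ha : ∀ j, a (j + 1) = a j * s - c j) (hb : ∀ j, b (j + 1) = b j * t - c j)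
    {i m : ℕ} (him : i ≤ m) :
    (s - t) * ∑ j ∈ Finset.Icc i m, a j * b (m + i - j) =
      a (m + 1) * b i - a i * b (m + 1) -
        ∑ j ∈ Finset.Icc i m, c j * (a (m + i - j) - b (m + i - j)) := by
  have reflect : ∑ j ∈ Finset.Icc i m, c j * a (m + i - j) =
      ∑ j ∈ Finset.Icc i m, c (m + i - j) * a j := by
    refine Finset.sum_nbij' (m + i - ·) (m + i - ·) ?_ ?_ ?_ ?_ ?_ <;>
      intro j hj <;> rw [Finset.mem_Icc] at hj
    · rw [Finset.mem_Icc]; omega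
    · rw [Finset.mem_Icc]; omega
    · omega
    · omega
    · rw [Nat.sub_sub_self (by omega)]
  have telescope : ∑ j ∈ Finset.Icc i m,
      (a (j + 1) * b (m + i + 1 - (j + 1)) - a j * b (m + i + 1 - j)) =
      a (m + 1) * b i - a i * b (m + 1) := by
    rw [← Finset.Ico_add_one_right_eq_Icc,
      Finset.sum_Ico_sub (fun j => a j * b (m + i + 1 - j)) (by omega),
      show m + i + 1 - (m + 1) = i by omega, show m + i + 1 - i = m + 1 by omega]
  simp only [mul_sub, Finset.sum_sub_distrib _ _] at telescope ⊢
  rw [reflect, ← telescope, Finset.mul_sum]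
  simp only [← Finset.sum_sub_distrib]
  refine Finset.sum_congr rfl fun j hj => ?_
  rw [Finset.mem_Icc] at hj
  rw [show m + i + 1 - (j + 1) = m + i - j by omega,
    show m + i + 1 - j = m + i - j + 1 by omega, ha, hb]
  ring

theorem evP_phiP_succ (A : ℕ → z) (xi : z) (l : Fin 2) (j : ℕ) :
    evP z l (phiP z A xi (j + 1)) =
      evP z l (phiP z A xi j) * (MvPolynomial.C xi * MvPolynomial.X l) - MvPolynomial.C (A j) := by
  simp [phiP, evP, MvPolynomial.algebraMap_eq]

/-- For 0 ≤ i ≤ m ≤ n and ξ ∈ 𝔷, in 𝔷[x,y]: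
ξ(x − y) Σ_{α=i}^{m} φ'_α φ''_{m+i−α}
  = φ'_{m+1} φ''_i − φ'_i φ''_{m+1} − Σ_{α=i}^{m} A_α Δ_{m+i−α},
where φ'_β = φ_β(ξ,x), φ''_β = φ_β(ξ,y) and Δ_β = φ'_β − φ''_β. -/
theorem phi_summation_identity [CharZero k]
    (n : ℕ) (hn : 1 ≤ n) (A : ℕ → z) (xi : z) (i m : ℕ) (him : i ≤ m) (hmn : m ≤ n) :
    MvPolynomial.C xi * (MvPolynomial.X 0 - MvPolynomial.X 1) *
        ∑ α ∈ Finset.Icc i m, evP z 0 (phiP z A xi α) * evP z 1 (phiP z A xi (m + i - α)) =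
      evP z 0 (phiP z A xi (m + 1)) * evP z 1 (phiP z A xi i) -
        evP z 0 (phiP z A xi i) * evP z 1 (phiP z A xi (m + 1)) -
        ∑ α ∈ Finset.Icc i m, MvPolynomial.C (A α) *
          (evP z 0 (phiP z A xi (m + i - α)) - evP z 1 (phiP z A xi (m + i - α))) := by
  rw [mul_sub]
  exact sum_mul_of_recurrence (a := fun j => evP z 0 (phiP z A xi j))
    (b := fun j => evP z 1 (phiP z A xi j)) (c := fun j => MvPolynomial.C (A j))
    (evP_phiP_succ z A xi 0) (evP_phiP_succ z A xi 1) him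

end Baxterization
end
end
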